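/- Let A = kQ_A/I_A where Q_A is the quiver 1 →^{α} 2 →^{β} 3 →^{γ} 5 →^{δ} 6 →^{λ} 7 together with an additional arrow 4 → 3, and I_A = ⟨λδγβα⟩. Then A is representation-finite and the nilpotency index of Re(mod A) equals 13. -/

import Mathlib

open CategoryTheory
open scoped Classical

/-! ## Quiver combinatorics -/

/-- Paths in a quiver given by source and target maps. -/
inductive QPath {V E : Type} (src tgt : E → V) : V → V → Type
  | nil (a : V) : QPath src tgt a a
  | cons {a b : V} (p : QPath src tgt a b) (α : E) (h : src α = b) : QPath src tgt a (tgt α)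

namespace QPath

variable {V E : Type} {src tgt : E → V}

def length : ∀ {a b : V}, QPath src tgt a b → ℕ
  | _, _, .nil _ => 0
  | _, _, .cons p _ _ => p.length + 1

def comp : ∀ {a b c : V}, QPath src tgt a b → QPath src tgt b c → QPath src tgt a c
  | _, _, _, p, .nil _ => p
  | _, _, _, p, .cons q α h => .cons (p.comp q) α h

/-- The list of vertices visited by a path, in order. -/
def verts : ∀ {a b : V}, QPath src tgt a b → List V
  | a, _, .nil _ => [a]
  | _, _, .cons p α _ => p.verts ++ [tgt α]

/-- The interior (intermediate) vertices of a path. -/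
def interior {a b : V} (p : QPath src tgt a b) : List V :=
  (p.verts.dropLast).drop 1

/-- The list of arrows of a path, in walk order. -/
def arrows : ∀ {a b : V}, QPath src tgt a b → List E
  | _, _, .nil _ => []
  | _, _, .cons p α _ => p.arrows ++ [α]

end QPath

/-- A presentation of the algebra `A` by the (ordinary) quiver with vertex set `V`
and arrow set `E` : a complete family of orthogonal primitive idempotents indexed by
the vertices together with generators indexed by the arrows. -/
structure QuiverPresentation (k A V E : Type) [Field k] [Ring A] [Algebra k A]
    [Fintype V] [Fintype E] where
  src : E → V
  tgt : E → V
  idem : V → A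
  arrow : E → A
  idem_idem : ∀ a : V, idem a * idem a = idem a
  idem_orth : ∀ a b : V, a ≠ b → idem a * idem b = 0
  sum_idem : ∑ a : V, idem a = 1
  idem_ne : ∀ a : V, idem a ≠ 0
  idem_primitive : ∀ (v : V) (f g : A), f * f = f → g * g = g → f * g = 0 → g * f = 0 →
    f + g = idem v → f = 0 ∨ g = 0
  arrow_mem : ∀ α : E, idem (tgt α) * arrow α * idem (src α) = arrow α
  arrow_ne : ∀ α : E, arrow α ≠ 0
  generates : Algebra.adjoin k (Set.range idem ∪ Set.range arrow) = ⊤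

namespace QuiverPresentation

variable {k A V E : Type} [Field k] [Ring A] [Algebra k A] [Fintype V] [Fintype E]

/-- The product in `A` of the arrows along a path (paths are written right to left). -/
def qprod (P : QuiverPresentation k A V E) :
    ∀ {a b : V}, QPath P.src P.tgt a b → A
  | _, _, .nil a => P.idem a
  | _, _, .cons p α _ => P.arrow α * P.qprod p

/-- The ideal of relations is admissible: all sufficiently long paths vanish. -/
def Admissible (P : QuiverPresentation k A V E) : Prop :=
  ∃ N : ℕ, ∀ (a b : V) (p : QPath P.src P.tgt a b), N ≤ p.length → P.qprod p = 0

/-- The presentation is minimal: the idempotents and the arrows are linearly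
independent modulo the span of the products of paths of length at least two,
so that `(V, E)` really is the ordinary quiver of `A`. -/
def Minimal (P : QuiverPresentation k A V E) : Prop :=
  ∀ (c : V → k) (d : E → k),
    ((∑ a : V, c a • P.idem a) + ∑ α : E, d α • P.arrow α) ∈
      Submodule.span k {x : A | ∃ (a b : V) (p : QPath P.src P.tgt a b),
        2 ≤ p.length ∧ P.qprod p = x} →
    (∀ a, c a = 0) ∧ (∀ α, d α = 0)

/-- The algebra is monomial: the ideal of relations is generated by paths; equivalently,
the images of the paths which do not vanish are linearly independent. -/
def Monomial (P : QuiverPresentation k A V E) : Prop :=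
  LinearIndependent k
    (fun q : {q : Σ a : V, Σ b : V, QPath P.src P.tgt a b // P.qprod q.2.2 ≠ 0} =>
      P.qprod q.1.2.2)

/-- A (minimal) zero-relation: a path of length at least two whose product vanishes
while the product along every proper subpath does not. -/
def IsZeroRel (P : QuiverPresentation k A V E) {a b : V} (p : QPath P.src P.tgt a b) : Prop :=
  P.qprod p = 0 ∧ 2 ≤ p.length ∧
  ∀ (x y : V) (q : QPath P.src P.tgt x y) (p₁ : QPath P.src P.tgt a x)
    (p₂ : QPath P.src P.tgt y b),
      p = p₁.comp (q.comp p₂) → q.length < p.length → P.qprod q ≠ 0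

/-- A vertex `u` is involved in a zero-relation `α_m ⋯ α_1` if `u = s(α_i)`
for some `i = 2, …, m`, i.e. `u` is an interior vertex of the relation. -/
def InvolvedInZeroRel (P : QuiverPresentation k A V E) (u : V) : Prop :=
  ∃ (a b : V) (p : QPath P.src P.tgt a b), P.IsZeroRel p ∧ u ∈ p.interior

/-! ### Walks (for strings and for connectivity) -/

/-- The starting vertex of a step (an arrow traversed forwards or backwards). -/
def stepSrc (P : QuiverPresentation k A V E) (s : E × Bool) : V :=
  if s.2 then P.src s.1 else P.tgt s.1

/-- The ending vertex of a step. -/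
def stepTgt (P : QuiverPresentation k A V E) (s : E × Bool) : V :=
  if s.2 then P.tgt s.1 else P.src s.1

/-- `l` is a walk from `a` to `b` in the underlying graph of the quiver. -/
def IsWalkFrom (P : QuiverPresentation k A V E) : V → List (E × Bool) → V → Prop
  | a, [], b => a = b
  | a, s :: l, b => P.stepSrc s = a ∧ P.IsWalkFrom (P.stepTgt s) l b

/-- The product in `A` of a list of arrows (listed in walk order). -/
def wprod (P : QuiverPresentation k A V E) (l : List E) : A :=
  ((l.map P.arrow).reverse).prod

/-- A reduced walk: no step is immediately followed by its inverse. -/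
def Reduced (l : List (E × Bool)) : Prop :=
  ¬ ∃ (l₁ : List (E × Bool)) (s : E × Bool) (l₂ : List (E × Bool)),
      l = l₁ ++ s :: (s.1, !s.2) :: l₂

/-- No direct subwalk of `l` nor the inverse of such lies in the ideal of relations. -/
def NoZeroSub (P : QuiverPresentation k A V E) (l : List (E × Bool)) : Prop :=
  ∀ (l₁ : List (E × Bool)) (r : List E) (l₂ : List (E × Bool)),
    (l = l₁ ++ (r.map (fun e => (e, true))) ++ l₂ → P.wprod r ≠ 0) ∧
    (l = l₁ ++ (r.map (fun e => (e, false))) ++ l₂ → P.wprod r.reverse ≠ 0)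

/-- A string from `a` to `b`. -/
def IsStringWalk (P : QuiverPresentation k A V E) (a : V) (l : List (E × Bool)) (b : V) : Prop :=
  P.IsWalkFrom a l b ∧ Reduced l ∧ P.NoZeroSub l

/-- `(Q_u^s)_0` : the strings starting at `u` that are trivial or start with an arrow. -/
def QSset (P : QuiverPresentation k A V E) (u : V) : Set (List (E × Bool)) :=
  {l | ∃ b : V, P.IsStringWalk u l b ∧ (l = [] ∨ ∃ (α : E) (l' : List (E × Bool)),
    l = (α, true) :: l')}

/-- `(Q_u^e)_0` : the strings ending at `u` that are trivial or end with an arrow. -/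
def QEset (P : QuiverPresentation k A V E) (u : V) : Set (List (E × Bool)) :=
  {l | ∃ a : V, P.IsStringWalk a l u ∧ (l = [] ∨ ∃ (α : E) (l' : List (E × Bool)),
    l = l' ++ [(α, true)])}

/-- `S_γ` : the strings starting with the arrow `γ`. -/
def Sarr (P : QuiverPresentation k A V E) (γ : E) : Set (List (E × Bool)) :=
  {l | ∃ b : V, P.IsStringWalk (P.src γ) l b ∧ ∃ l' : List (E × Bool), l = (γ, true) :: l'}

/-- `E_γ` : the strings ending with the arrow `γ`. -/
def Earr (P : QuiverPresentation k A V E) (γ : E) : Set (List (E × Bool)) :=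
  {l | ∃ a : V, P.IsStringWalk a l (P.tgt γ) ∧ ∃ l' : List (E × Bool), l = l' ++ [(γ, true)]}

/-- The defining conditions of a string algebra. -/
def IsStringAlgebra (P : QuiverPresentation k A V E) : Prop :=
  P.Monomial ∧
  (∀ v : V, Nat.card {α : E // P.src α = v} ≤ 2) ∧
  (∀ v : V, Nat.card {α : E // P.tgt α = v} ≤ 2) ∧
  (∀ γ : E, Nat.card {β : E // P.src β = P.tgt γ ∧ P.arrow β * P.arrow γ ≠ 0} ≤ 1) ∧
  (∀ β : E, Nat.card {γ : E // P.src β = P.tgt γ ∧ P.arrow β * P.arrow γ ≠ 0} ≤ 1)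

/-- Connectivity in the underlying graph, avoiding a given set of arrows. -/
def ConnAvoid (P : QuiverPresentation k A V E) (avoid : Set E) (a b : V) : Prop :=
  ∃ l : List (E × Bool), P.IsWalkFrom a l b ∧ ∀ s ∈ l, s.1 ∉ avoid

def Connected (P : QuiverPresentation k A V E) : Prop := ∀ a b : V, P.ConnAvoid ∅ a b

/-- The underlying graph of the quiver is a tree. -/
def IsTreeQuiver (P : QuiverPresentation k A V E) : Prop :=
  P.Connected ∧ Fintype.card E + 1 = Fintype.card V

/-- The underlying (undirected) graph of the quiver is given by the edge-endpoint
specification `ends` on `nV` vertices and `nE` edges. -/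
def GraphSpec (P : QuiverPresentation k A V E) (nV nE : ℕ) (ends : Fin nE → ℕ × ℕ) : Prop :=
  ∃ (v : Fin nV ≃ V) (ar : Fin nE ≃ E), ∀ i : Fin nE, ∃ a b : Fin nV,
    (a : ℕ) = (ends i).1 ∧ (b : ℕ) = (ends i).2 ∧
    ((P.src (ar i) = v a ∧ P.tgt (ar i) = v b) ∨ (P.src (ar i) = v b ∧ P.tgt (ar i) = v a))

/-- The directed quiver is given by the arrow specification `ends`. -/
def DirGraphSpec (P : QuiverPresentation k A V E) (nV nE : ℕ) (ends : Fin nE → ℕ × ℕ) : Prop :=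
  ∃ (v : Fin nV ≃ V) (ar : Fin nE ≃ E), ∀ i : Fin nE, ∃ a b : Fin nV,
    (a : ℕ) = (ends i).1 ∧ (b : ℕ) = (ends i).2 ∧
    P.src (ar i) = v a ∧ P.tgt (ar i) = v b

/-- The underlying graph of the full subquiver on vertices `S` and arrows `T`. -/
def SubGraphSpec (P : QuiverPresentation k A V E) (S : Set V) (T : Set E)
    (nV nE : ℕ) (ends : Fin nE → ℕ × ℕ) : Prop :=
  ∃ (v : Fin nV ≃ S) (ar : Fin nE ≃ T), ∀ i : Fin nE, ∃ a b : Fin nV,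
    (a : ℕ) = (ends i).1 ∧ (b : ℕ) = (ends i).2 ∧
    ((P.src (ar i) = v a ∧ P.tgt (ar i) = v b) ∨ (P.src (ar i) = v b ∧ P.tgt (ar i) = v a))

end QuiverPresentation

/-- Edge endpoints of the Dynkin graph `A_n`. -/
def typeAEnds (n : ℕ) : Fin (n - 1) → ℕ × ℕ := fun i => ((i : ℕ), (i : ℕ) + 1)

/-- Edge endpoints of the Dynkin graph `D_n`. -/
def typeDEnds (n : ℕ) : Fin (n - 1) → ℕ × ℕ := fun i =>
  if (i : ℕ) = 0 then (0, 2) else if (i : ℕ) = 1 then (1, 2) else ((i : ℕ), (i : ℕ) + 1)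

/-- Edge endpoints of the Dynkin graph `E_m` for `m = 6, 7, 8`. -/
def typeEEnds (m : ℕ) : Fin (m - 1) → ℕ × ℕ := fun i =>
  if (i : ℕ) = m - 2 then (2, m - 1) else ((i : ℕ), (i : ℕ) + 1)

/-! ## The module category, its radical and the nilpotency index -/

section ModuleSide

variable (A : Type) [Ring A]

/-- An indecomposable module: non-zero, with no non-trivial idempotent endomorphism. -/
def Indec (M : ModuleCat.{0} A) : Prop :=
  Nontrivial M ∧ ∀ f : M ⟶ M, f ≫ f = f → f = 0 ∨ f = 𝟙 M

/-- A finitely generated indecomposable module. -/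
def FinIndec (M : ModuleCat.{0} A) : Prop := Module.Finite A M ∧ Indec A M

/-- `A` is representation-finite: finitely many finitely generated indecomposables
up to isomorphism. -/
def RepFinite : Prop :=
  ∃ (n : ℕ) (T : Fin n → ModuleCat.{0} A),
    ∀ M : ModuleCat.{0} A, FinIndec A M → ∃ i, Nonempty (M ≅ T i)

/-- `A` is (left) hereditary. -/
def Hereditary : Prop := ∀ I : Submodule A A, Module.Projective A I

/-- An irreducible morphism: it does not split, and in any factorization one of
the factors splits. -/
def IrredMor {X Y : ModuleCat.{0} A} (f : X ⟶ Y) : Prop :=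
  (¬ ∃ g : Y ⟶ X, f ≫ g = 𝟙 X) ∧ (¬ ∃ g : Y ⟶ X, g ≫ f = 𝟙 Y) ∧
  ∀ (Z : ModuleCat.{0} A), Module.Finite A Z → ∀ (u : X ⟶ Z) (v : Z ⟶ Y), f = u ≫ v →
    (∃ r : Z ⟶ X, u ≫ r = 𝟙 X) ∨ (∃ s : Y ⟶ Z, s ≫ v = 𝟙 Y)

/-- The radical of `Hom(X, Y)`. -/
def radSet (X Y : ModuleCat.{0} A) : Set (X ⟶ Y) :=
  {f | ∀ M : ModuleCat.{0} A, FinIndec A M →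
    ∀ (h : M ⟶ X) (h' : Y ⟶ M), ¬ IsIso (h ≫ f ≫ h')}

/-- Compositions of `n` radical morphisms. -/
def radPowSet : ℕ → ∀ (X Y : ModuleCat.{0} A), Set (X ⟶ Y)
  | 0, _, _ => Set.univ
  | n + 1, X, Y => {f | ∃ (M : ModuleCat.{0} A) (g : X ⟶ M) (h : M ⟶ Y),
      Module.Finite A M ∧ g ∈ radSet A X M ∧ h ∈ radPowSet n M Y ∧ f = g ≫ h}

/-- The `n`-th power of the radical of `mod A` vanishes. -/
def RadVanishes (n : ℕ) : Prop :=
  ∀ X Y : ModuleCat.{0} A, Module.Finite A X → Module.Finite A Y →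
    ∀ f ∈ radPowSet A n X Y, f = 0

/-- `m` is the nilpotency index of the radical of `mod A`. -/
def NilpotencyIndex (m : ℕ) : Prop :=
  1 ≤ m ∧ RadVanishes A m ∧ ∀ l : ℕ, RadVanishes A l → m ≤ l

/-- A path of irreducible morphisms between (f.g.) indecomposable modules,
together with its composite morphism and its length. -/
inductive IrrPath : ∀ (M N : ModuleCat.{0} A), (M ⟶ N) → ℕ → Prop
  | nil (M : ModuleCat.{0} A) : FinIndec A M → IrrPath M M (𝟙 M) 0
  | cons {M X N : ModuleCat.{0} A} (f : M ⟶ X) (g : X ⟶ N) (n : ℕ) :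
      FinIndec A M → IrredMor A f → IrrPath X N g n → IrrPath M N (f ≫ g) (n + 1)

/-- The Auslander–Reiten quiver of `A` is a component with length : parallel paths
of irreducible morphisms have the same length. -/
def WithLength : Prop :=
  ∀ (M N : ModuleCat.{0} A) (n m : ℕ),
    (∃ f : M ⟶ N, IrrPath A M N f n) → (∃ g : M ⟶ N, IrrPath A M N g m) → n = m

/-- `N` is a successor of `M` (a path of non-zero morphisms between f.g.
indecomposables from `M` to `N`). -/
inductive Reach : ModuleCat.{0} A → ModuleCat.{0} A → Prop
  | refl (M : ModuleCat.{0} A) : FinIndec A M → Reach M M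
  | cons {M X N : ModuleCat.{0} A} : FinIndec A M → FinIndec A X →
      (∃ f : M ⟶ X, f ≠ 0) → Reach X N → Reach M N

/-- `N` is a direct summand of `M`. -/
def IsSummand (N M : ModuleCat.{0} A) : Prop :=
  ∃ (i : N ⟶ M) (p : M ⟶ N), i ≫ p = 𝟙 N

/-- The radical of a module (intersection of the maximal submodules). -/
def radOf (M : ModuleCat.{0} A) : Submodule A M := sInf {N | IsCoatom N}

/-- The socle of a module (sum of the simple submodules). -/
def socOf (M : ModuleCat.{0} A) : Submodule A M := sSup {N | IsAtom N}

/-- `0 → X → E → Y → 0` is an almost split (Auslander–Reiten) sequence. -/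
def IsAlmostSplit {X E Y : ModuleCat.{0} A} (f : X ⟶ E) (g : E ⟶ Y) : Prop :=
  FinIndec A X ∧ FinIndec A Y ∧ Module.Finite A E ∧
  Function.Injective f ∧ Function.Surjective g ∧
  (∀ x : X, g (f x) = 0) ∧ (∀ e : E, g e = 0 → ∃ x : X, f x = e) ∧
  (¬ ∃ s : Y ⟶ E, s ≫ g = 𝟙 Y) ∧
  (∀ (M : ModuleCat.{0} A) (h : X ⟶ M), (¬ ∃ r : M ⟶ X, h ≫ r = 𝟙 X) →
    ∃ t : E ⟶ M, f ≫ t = h) ∧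
  (∀ (M : ModuleCat.{0} A) (h : M ⟶ Y), (¬ ∃ s : Y ⟶ M, s ≫ h = 𝟙 Y) →
    ∃ t : M ⟶ E, t ≫ g = h)

/-- `X = τ Y` : there is an almost split sequence `0 → X → E → Y → 0`. -/
def IsTauOf (X Y : ModuleCat.{0} A) : Prop :=
  ∃ (E : ModuleCat.{0} A) (f : X ⟶ E) (g : E ⟶ Y), IsAlmostSplit A f g

/-- A sectional path of irreducible morphisms of length `n` from `M` to `N`. -/
def SectionalPath (M N : ModuleCat.{0} A) (n : ℕ) : Prop :=
  ∃ Y : Fin (n + 1) → ModuleCat.{0} A,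
    Y 0 = M ∧ Y (Fin.last n) = N ∧ (∀ i, FinIndec A (Y i)) ∧
    (∀ i : Fin n, ∃ f : Y i.castSucc ⟶ Y i.succ, IrredMor A f) ∧
    ∀ (i : ℕ) (h : i + 2 ≤ n),
      ¬ IsTauOf A (Y ⟨i, by omega⟩) (Y ⟨i + 2, by omega⟩)

end ModuleSide

/-! ## Modules attached to vertices -/

section Vertices

variable {k A V E : Type} [Field k] [Ring A] [Algebra k A] [Fintype V] [Fintype E]

/-- `S` is the simple module at the vertex `a`. -/
def IsSimpleAt (P : QuiverPresentation k A V E) (a : V) (S : ModuleCat.{0} A) : Prop :=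
  IsSimpleModule A S ∧ ∃ x : S, P.idem a • x ≠ 0

/-- `Pm` is the indecomposable projective at the vertex `a`. -/
def IsProjAt (P : QuiverPresentation k A V E) (a : V) (Pm : ModuleCat.{0} A) : Prop :=
  Module.Projective A Pm ∧ FinIndec A Pm ∧
  ∃ (S : ModuleCat.{0} A) (f : Pm ⟶ S), IsSimpleAt P a S ∧ Function.Surjective f

/-- `Im` is the indecomposable injective at the vertex `a`. -/
def IsInjAt (P : QuiverPresentation k A V E) (a : V) (Im : ModuleCat.{0} A) : Prop :=
  Module.Injective A Im ∧ FinIndec A Im ∧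
  ∃ (S : ModuleCat.{0} A) (f : S ⟶ Im), IsSimpleAt P a S ∧ Function.Injective f

/-- `RVal P a n` : `n` is the length of a non-zero path of irreducible morphisms
between indecomposable modules from `P_a` to `I_a` going through `S_a`. -/
def RVal (P : QuiverPresentation k A V E) (a : V) (n : ℕ) : Prop :=
  ∃ (Pm S Im : ModuleCat.{0} A) (f : Pm ⟶ S) (g : S ⟶ Im) (n₁ n₂ : ℕ),
    IsProjAt P a Pm ∧ IsSimpleAt P a S ∧ IsInjAt P a Im ∧
    IrrPath A Pm S f n₁ ∧ IrrPath A S Im g n₂ ∧ f ≫ g ≠ 0 ∧ n = n₁ + n₂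

end Vertices


/-- Arrow endpoints of the quiver of Example 3.16 (vertices `1, …, 7` are indexed
`0, …, 6`) : arrows `1 → 2 → 3 → 5 → 6 → 7` and `4 → 3`. -/
def ex18Ends : Fin 6 → ℕ × ℕ := ![(0, 1), (1, 2), (2, 4), (4, 5), (5, 6), (3, 2)]

/-! ## The Auslander–Reiten quiver of the algebra

Every indecomposable module is described by the list of vertices carrying its basis vectors.
Matrices with entries in `{0, 1, -1}` are encoded by the base three digits of a natural number,
row by row. -/

/-- A vertex of the Auslander–Reiten quiver: the vertices of the basis vectors, the matrix of the
sum of all arrows, the arrows `i → j` with the matrices of the irreducible map and of the two maps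
splitting the mesh which starts at `i`, the inverse translate and the level. -/
structure MeshRow where
  verts : List (Fin 7)
  shift : ℕ
  arrows : List (Fin 46 × ℕ × ℕ × ℕ)
  translate : Option (Fin 46)
  level : ℕ

namespace MeshRow

def table : List MeshRow := [
  ⟨[6], 0, [(1, 3, 3, 1)], some 2, 0⟩,
  ⟨[5, 6], 9, [(3, 252, 246, 1), (2, 1, 0, 3)], some 4, 1⟩,
  ⟨[5], 0, [(4, 3, 3, 1)], some 5, 2⟩,
  ⟨[4, 5, 6], 2214, [(6, 179361, 177879, 1), (4, 163, 0, 246)], some 7, 2⟩,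
  ⟨[4, 5], 18, [(7, 252, 246, 1), (5, 1, 0, 3)], some 8, 3⟩,
  ⟨[4], 0, [(8, 3, 3, 1)], some 9, 4⟩,
  ⟨[2, 4, 5, 6], 4802733, [(10, 1167064200, 1163857980, 1), (11, 1167064200, 0,
    984776461275559025163), (7, 59536, 0, 847293392439)], some 12, 3⟩,
  ⟨[2, 4, 5], 4428, [(12, 94186245231, 847293392439, 7509466573129461957081411333087010), (8,
    163, 0, 1594350)], some 13, 4⟩,
  ⟨[2, 4], 9, [(13, 177876, 1594350, 174475799825332156806363418), (9, 1, 0, 27)], some 14, 5⟩,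
  ⟨[2], 0, [(14, 27, 27, 36489681184472723116)], some 15, 6⟩,
  ⟨[1, 2, 4, 5, 6], 94272496380, [(12, 1972254633612147612928, 1969552922551118050321,
    617704778937960)], some 16, 4⟩,
  ⟨[3, 2, 4, 5, 6], 94272496380, [(12, 984776461275559025403, 984776461275559025163,
    1235378176816150)], some 17, 4⟩,
  ⟨[1, 3, 2, 2, 4, 4, 5, 5, 6], 16423759529749833764737247923008113730, [(16, 27795428357901789,
    81, 7625984925159), (17, 33354457543574848, 1235378176816150, 0), (13,
    7509508906855910165919327649422547, 7509466573129461957081411333067326,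
    12157665741486471844)], some 18, 5⟩,
  ⟨[1, 3, 2, 2, 4, 4, 5, 6], 381526885887108703160830345332, [(18, 58152691615943507103012214,
    79778604448654417085608, 0), (14, 174458074097349718451675704, 174449211009120179071170507,
    50054432356593028)], some 19, 6⟩,
  ⟨[1, 3, 2, 2, 4, 5, 6], 26592867120022598979954, [(19, 12159518761718370406, 50054432356593028,
    0), (15, 36478556285069004652, 36472996377170786403, 282817489141)], some 20, 7⟩,
  ⟨[1, 3, 2, 4, 5, 6], 16684810786593162, [(20, 22887257593321, 282817489141, 0)], none, 8⟩,
  ⟨[3, 2, 4, 5], 9605466, [(18, 7625984925321, 7625984925165, 129199213)], some 21, 6⟩,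
  ⟨[1, 2, 4, 5], 4802733, [(22, 1167064200, 1163857980, 1), (18, 7689137653514, 0,
    174458074397546615418039279)], some 23, 6⟩,
  ⟨[1, 3, 2, 2, 4, 4, 5], 17727227502815423641293, [(21, 1162320517, 129199213, 0), (23,
    174475803876652057147248429, 174449211459404086124488386, 92709463148882607987945536820616),
    (19, 72947846057046067694, 0, 14130465858331906859861877324)], some 24, 7⟩,
  ⟨[1, 3, 2, 2, 4, 5], 16679724342993081, [(24, 14136847177682369352434364324,
    14130465858331906859861877324, 834385168331092691437316385683134), (20, 137323526419298, 0,
    984787579459454609727)], some 25, 8⟩,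
  ⟨[1, 3, 2, 4, 5], 94272614235, [(25, 986121761526924815727, 984787579459454609727,
    7625984905720)], some 26, 9⟩,
  ⟨[1, 2, 4], 2214, [(24, 190614070017, 15251204535918, 834512341814770471353864543610639)], some
    27, 8⟩,
  ⟨[0, 1, 2, 4, 5], 94272496380, [(23, 8110692275036303683, 8105178938739860035, 3488379453)],
    some 28, 7⟩,
  ⟨[0, 1, 3, 2, 2, 4, 4, 5], 254353411389705945845149296000, [(28, 52302474612, 729, 4785156),
    (24, 49271278956639061405114843317134980003, 49269702523665380715844912562606793568,
    5559060609661293)], some 29, 8⟩,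
  ⟨[0, 1, 1, 3, 2, 2, 2, 4, 4, 5], 57264204887971785271314739028510393676524143470, [(27,
    834389878470610309972351216747786, 834512341805907533234212028165803,
    239299329230617530121524), (29, 212710664968554761187597, 5559060566614572,
    6461081889249550096170171), (25, 2909337612658548706886705680627259711542027,
    834385168331092691437316385683133, 57264276722860124665971980764903164348406330672)], some
    30, 9⟩,
  ⟨[0, 1, 1, 3, 2, 2, 4, 4, 5], 49269887937881697499850223521235249156, [(30,
    57265138760376750151236805525159727854270066639,
    57264276723062880261876672633938956296809937406, 4052555156505760668), (26, 5559091947674182,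
    0, 94186227736)], some 31, 10⟩,
  ⟨[0, 1, 2, 4], 4802733, [(31, 94530599560, 94186227736, 2268)], some 32, 11⟩,
  ⟨[0, 1, 3, 2, 2, 4, 5], 26590165348092836309874, [(30, 3650157110245433589533356091150023874,
    3649601870841658988937386306789180948, 4052761044280217640)], some 33, 10⟩,
  ⟨[3, 2, 4], 2214, [(29, 4785210, 4785162, 2188)], some 34, 9⟩,
  ⟨[1, 3, 2, 2, 4], 31410170766, [(34, 6562, 2188, 0), (30, 984772800957428159949,
    6461081889249550096170171, 323274333132569968426230681733432962081040)], some 35, 10⟩,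
  ⟨[0, 1, 1, 3, 3, 2, 2, 2, 4, 4, 5], 599003809015729982714726138767701179105570298800594200467,
    [(33, 145892077015876880310, 2541865834890, 7625597544036), (35,
    323258518196343768313759825751787391268872, 323274333132570007192722017093472368253997,
    14348907), (31, 2289123025467087710442612674351, 38766491335360043280377847,
    5559907855184650)], some 36, 11⟩,
  ⟨[0, 1, 3, 2, 2, 4], 27796157094956589, [(36, 36489681187956316684, 36478556285155111216, 27),
    (32, 19692, 0, 246)], some 37, 12⟩,
  ⟨[3, 2], 18, [(37, 252, 246, 1)], some 38, 13⟩,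
  ⟨[1, 3, 2, 4], 4815774, [(36, 7626373920450, 7626372385020, 129142351)], some 39, 12⟩,
  ⟨[1, 2], 18, [(35, 19773, 531444, 26600977583480615150836)], some 40, 11⟩,
  ⟨[0, 1, 1, 3, 2, 2, 4, 5], 381539808306192571804412402148, [(40, 26590165279306716004642,
    26600977583480613556513, 729), (36, 116300459377376095633319053, 5559060580943796,
    16677275971985560)], some 41, 12⟩,
  ⟨[0, 1, 1, 3, 2, 2, 4], 44315142254775948557637, [(39, 1162281151, 129142351, 0), (41,
    16683112849125322, 16677181828806732, 14349151), (37, 774959079, 9565965, 729)], some 42,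
    13⟩,
  ⟨[1, 3, 2], 5103, [(42, 179361, 177879, 1), (38, 1, 0, 3)], some 43, 14⟩,
  ⟨[1], 0, [(43, 3, 3, 1)], some 44, 15⟩,
  ⟨[0, 1, 2], 2214, [(42, 177230, 177392, 9)], some 45, 14⟩,
  ⟨[0, 1, 3, 2, 4, 5], 16684813108459620, [(41, 22897717946525, 283204909631, 0)], none, 13⟩,
  ⟨[0, 1, 3, 2, 4], 188587685187, [(42, 387952660, 14408200, 0)], none, 14⟩,
  ⟨[0, 1, 3, 2], 11160423, [(45, 9, 9, 0), (43, 487, 55, 0)], none, 15⟩,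
  ⟨[0, 1], 9, [(44, 1, 1, 0)], none, 16⟩,
  ⟨[0], 0, [], none, 17⟩,
  ⟨[3], 0, [], none, 16⟩]

/-- The `(r, p)` entry of an encoded matrix with `w` columns. -/
def trit (N w r p : ℕ) : ℤ :=
  match N / 3 ^ (r * w + p) % 3 with
  | 0 => 0
  | 1 => 1
  | _ => -1

/-- The `(r, p)` entry of the product of two encoded matrices with `w` and `w'` columns. -/
def dot (N w N' w' r p : ℕ) : ℤ :=
  Nat.rec 0 (fun q s =>
    match N / 3 ^ (r * w + q) % 3 with
    | 0 => s
    | 1 => s + trit N' w' q p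
    | _ => s - trit N' w' q p) w

def row (i : Fin 46) : MeshRow := table.getD i ⟨[], 0, [], none, 0⟩

def dim (i : Fin 46) : ℕ := (row i).verts.length

def vert (i : Fin 46) (r : ℕ) : Fin 7 := (row i).verts.getD r 0

def lvl (i : Fin 46) : ℕ := (row i).level

def succ (i : Fin 46) : List (Fin 46) := (row i).arrows.map Prod.fst

def codes (i j : Fin 46) : ℕ × ℕ × ℕ := ((row i).arrows.lookup j).getD (0, 0, 0)

/-- The code of the sum of all arrows on the module `i`. -/
def shiftCode (i : Fin 46) : ℕ := (row i).shift

/-- The code of the irreducible map `i → j`. -/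
def arrowCode (i j : Fin 46) : ℕ := (codes i j).1

/-- The code of a linear map `j → i` which is part of a splitting of the mesh at `i`. -/
def retractCode (i j : Fin 46) : ℕ := (codes i j).2.1

/-- The code of a linear map `y → j`, where `y` is the end of the mesh at `i`, which is part of
a splitting of this mesh. -/
def sectionCode (i j : Fin 46) : ℕ := (codes i j).2.2

/-- The successor of a vertex in the quiver `0 → 1 → 2 → 4 → 5 → 6`, `3 → 2`. -/
def nextVert : Fin 7 → Fin 7 := ![1, 2, 4, 2, 5, 6, 6]

/-- The number of nonzero paths starting at a vertex. -/
def pathCount : Fin 7 → ℕ := ![5, 5, 4, 5, 3, 2, 1]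

/-- The position of the projective modules in the table. -/
def proj : Fin 7 → Fin 46 := ![22, 10, 6, 11, 3, 1, 0]

theorem lt_of_mem_succ : ∀ i, ∀ j ∈ succ i, i < j := by decide +kernel

theorem nodup_succ : ∀ i, (succ i).Nodup := by decide +kernel

theorem mem_succ_of_translate : ∀ i, ∀ y ∈ (row i).translate, ∀ j ∈ succ i, y ∈ succ j := by
  decide +kernel

theorem lvl_of_mem_succ : ∀ i, ∀ j ∈ succ i, lvl j = lvl i + 1 := by decide +kernel

theorem vert_ne_of_lvl : ∀ (a : Fin 7) (j : Fin 46), lvl j = lvl (proj a) + 13 →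
    ∀ r < dim j, vert j r ≠ a := by decide +kernel

theorem dim_pos : ∀ i, 0 < dim i := by decide +kernel

theorem shiftCode_graded : ∀ i, ∀ r < dim i, ∀ p < dim i,
    trit (shiftCode i) (dim i) r p = 0 ∨ vert i p ≠ 6 ∧ vert i r = nextVert (vert i p) := by
  decide +kernel

theorem vert_zero_six : ∀ i, (∀ r < dim i, vert i r ≠ 0) ∨ (∀ r < dim i, vert i r ≠ 6) := by
  decide +kernel

theorem arrowCode_graded : ∀ i, ∀ j ∈ succ i, ∀ r < dim j, ∀ p < dim i,
    trit (arrowCode i j) (dim i) r p = 0 ∨ vert j r = vert i p := by decide +kernel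

theorem arrowCode_shift : ∀ i, ∀ j ∈ succ i, ∀ r < dim j, ∀ p < dim i,
    dot (arrowCode i j) (dim i) (shiftCode i) (dim i) r p =
      dot (shiftCode j) (dim j) (arrowCode i j) (dim i) r p := by decide +kernel

theorem mesh_comp : ∀ i, ∀ y ∈ (row i).translate, ∀ r < dim y, ∀ p < dim i,
    ((succ i).map fun j => dot (arrowCode j y) (dim j) (arrowCode i j) (dim i) r p).sum = 0 := by
  decide +kernel

theorem mesh_section : ∀ i, ∀ y ∈ (row i).translate, ∀ r < dim y, ∀ p < dim y,
    ((succ i).map fun j => dot (arrowCode j y) (dim j) (sectionCode i j) (dim y) r p).sum =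
      if r = p then 1 else 0 := by decide +kernel

theorem mesh_split : ∀ i, ∀ y ∈ (row i).translate, ∀ j ∈ succ i, ∀ l ∈ succ i,
    ∀ r < dim j, ∀ p < dim l,
    dot (arrowCode i j) (dim i) (retractCode i l) (dim l) r p +
      dot (sectionCode i j) (dim y) (arrowCode l y) (dim l) r p =
      if j = l ∧ r = p then 1 else 0 := by decide +kernel

theorem end_split : ∀ i, (row i).translate = none → ∀ j ∈ succ i, ∀ l ∈ succ i,
    ∀ r < dim j, ∀ p < dim l,
    dot (arrowCode i j) (dim i) (retractCode i l) (dim l) r p =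
      if j = l ∧ r = p then 1 else 0 := by decide +kernel

theorem dim_additive : ∀ j, dim j + ((List.finRange 46).map fun i =>
      if j ∈ (row i).translate then dim i else 0).sum =
    (if j ∈ (List.finRange 7).map proj then 1 else 0) + ((List.finRange 46).map fun i =>
      if j ∈ succ i then dim i else 0).sum := by decide +kernel

theorem proj_injective : Function.Injective proj := by decide +kernel

theorem dim_ne_sum : ∀ i, ∀ s ∈ (succ i).sublists, (s.map dim).sum ≠ dim i := by decide +kernel

theorem dim_proj : ∀ a, dim (proj a) = pathCount a := by decide +kernel

theorem vert_proj : ∀ a, ∀ r < dim (proj a), vert (proj a) r = nextVert^[r] a := by decide +kernel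

theorem shiftCode_proj : ∀ a, ∀ r < dim (proj a), ∀ p < dim (proj a),
    trit (shiftCode (proj a)) (dim (proj a)) r p = if r = p + 1 then 1 else 0 := by
  decide +kernel

theorem exists_target : vert 45 0 = 3 ∧ lvl 45 = lvl (proj 3) + 12 := by decide +kernel

end MeshRow

section UniversalProperty

variable {k A B : Type} [Field k] [Ring A] [Algebra k A] [Ring B] [Algebra k B]

/-- Orthogonal idempotents `e` and an element `x` satisfying the relations of the bound quiver
algebra, `x` being the sum of all arrows. -/
structure ShiftRelations (e : Fin 7 → A) (x : A) : Prop where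
  idem_mul : ∀ a b, e a * e b = if a = b then e b else 0
  sum_idem : ∑ a, e a = 1
  shift_mul : ∀ a, x * e a = e (MeshRow.nextVert a) * (x * e a)
  shift_last : x * e 6 = 0
  shift_pow : x ^ 5 * e 0 = 0

namespace ShiftRelations

variable {e : Fin 7 → A} {x : A}

theorem pow_succ_mul (h : ShiftRelations e x) (n : ℕ) (a : Fin 7) :
    x ^ n * e a = e (MeshRow.nextVert^[n] a) * (x ^ n * e a) := by
  induction n with
  | zero => simp [h.idem_mul]
  | succ n ih =>
    rw [pow_succ', mul_assoc, ih, ← mul_assoc x, h.shift_mul, Function.iterate_succ_apply']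
    simp only [mul_assoc]
    rw [← mul_assoc (e _) (e _) (x * _), h.idem_mul, if_pos rfl]

theorem idem_mul_pow (h : ShiftRelations e x) (b : Fin 7) (n : ℕ) (a : Fin 7) :
    e b * (x ^ n * e a) = if MeshRow.nextVert^[n] a = b then x ^ n * e a else 0 := by
  rw [h.pow_succ_mul, ← mul_assoc, h.idem_mul]
  by_cases hb : MeshRow.nextVert^[n] a = b
  · simp [hb]
  · simp [hb, Ne.symm hb]

theorem pow_mul_eq_zero (h : ShiftRelations e x) (a : Fin 7) (n : ℕ)
    (hn : MeshRow.pathCount a ≤ n) : x ^ n * e a = 0 := by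
  obtain ⟨m, rfl⟩ := Nat.exists_eq_add_of_le' hn
  rw [pow_add, mul_assoc]
  suffices x ^ MeshRow.pathCount a * e a = 0 by rw [this, mul_zero]
  by_cases ha : a = 0
  · subst ha; exact h.shift_pow
  · have key : ∀ l, MeshRow.nextVert^[l] a = 6 → x ^ (l + 1) * e a = 0 := fun l hl => by
      rw [pow_succ', mul_assoc, h.pow_succ_mul, hl, ← mul_assoc, h.shift_last, zero_mul]
    obtain ⟨hl, h6⟩ : MeshRow.pathCount a = MeshRow.pathCount a - 1 + 1 ∧
        MeshRow.nextVert^[MeshRow.pathCount a - 1] a = 6 := by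
      clear hn key
      revert a
      decide
    exact hl ▸ key _ h6

/-- The products of arrows along paths. -/
def pathElem (e : Fin 7 → A) (x : A) (q : Σ a : Fin 7, Fin (MeshRow.pathCount a)) : A :=
  x ^ (q.2 : ℕ) * e q.1

theorem span_eq_top (h : ShiftRelations e x)
    (hgen : Algebra.adjoin k (insert x (Set.range e)) = ⊤) :
    ⊤ ≤ Submodule.span k (Set.range (pathElem e x)) := by
  set W := Submodule.span k (Set.range (pathElem e x)) with hW
  have hmem : ∀ n a, x ^ n * e a ∈ W := fun n a => by
    by_cases hn : MeshRow.pathCount a ≤ n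
    · rw [h.pow_mul_eq_zero a n hn]; exact W.zero_mem
    · exact Submodule.subset_span ⟨⟨a, ⟨n, not_le.1 hn⟩⟩, rfl⟩
  have hone : (1 : A) ∈ W := by
    rw [← h.sum_idem]
    exact W.sum_mem fun a _ => by simpa using hmem 0 a
  have hmul : ∀ y ∈ Algebra.adjoin k (insert x (Set.range e)), ∀ w ∈ W, y * w ∈ W := by
    intro y hy
    induction hy using Algebra.adjoin_induction with
    | mem y hy =>
      intro w hw
      induction hw using Submodule.span_induction with
      | mem w hw =>
        obtain ⟨⟨a, n⟩, rfl⟩ := hw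
        rcases hy with rfl | ⟨b, rfl⟩
        · rw [pathElem, ← mul_assoc, ← pow_succ']
          exact hmem _ _
        · rw [pathElem, h.idem_mul_pow]
          split_ifs
          · exact hmem _ _
          · exact W.zero_mem
      | zero => rw [mul_zero]; exact W.zero_mem
      | add u w _ _ hu hw => rw [mul_add]; exact W.add_mem hu hw
      | smul c w _ hw => rw [mul_smul_comm]; exact W.smul_mem c hw
    | algebraMap c =>
      intro w hw
      rw [← Algebra.smul_def]
      exact W.smul_mem c hw
    | add y z _ _ hy hz => intro w hw; rw [add_mul]; exact W.add_mem (hy w hw) (hz w hw)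
    | mul y z _ _ hy hz => intro w hw; rw [mul_assoc]; exact hy _ (hz w hw)
  intro y _
  simpa using hmul y (by rw [hgen]; trivial) 1 hone

theorem exists_algHom (h : ShiftRelations e x)
    (hgen : Algebra.adjoin k (insert x (Set.range e)) = ⊤)
    (hdim : Module.finrank k A = 25) {e' : Fin 7 → B} {x' : B} (h' : ShiftRelations e' x') :
    ∃ φ : A →ₐ[k] B, (∀ a, φ (e a) = e' a) ∧ φ x = x' := by
  have hcard : Fintype.card (Σ a : Fin 7, Fin (MeshRow.pathCount a)) = Module.finrank k A := by
    rw [hdim]; decide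
  let b := basisOfTopLeSpanOfCardEqFinrank (pathElem e x) (h.span_eq_top hgen) hcard
  let φ : A →ₗ[k] B := b.constr k (pathElem e' x')
  have hφ : ∀ n a, φ (x ^ n * e a) = x' ^ n * e' a := fun n a => by
    by_cases hn : MeshRow.pathCount a ≤ n
    · rw [h.pow_mul_eq_zero a n hn, h'.pow_mul_eq_zero a n hn, map_zero]
    · have := b.constr_basis k (pathElem e' x') ⟨a, ⟨n, not_le.1 hn⟩⟩
      rwa [coe_basisOfTopLeSpanOfCardEqFinrank] at this
  have he : ∀ a, φ (e a) = e' a := fun a => by simpa using hφ 0 a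
  have hone : φ 1 = 1 := by
    rw [← h.sum_idem, map_sum, ← h'.sum_idem]
    exact Finset.sum_congr rfl fun a _ => he a
  have hx : φ x = x' := by
    have : x = ∑ a, x ^ 1 * e a := by rw [← Finset.mul_sum, h.sum_idem, pow_one, mul_one]
    rw [this, map_sum, Finset.sum_congr rfl fun a _ => hφ 1 a, ← Finset.mul_sum, h'.sum_idem,
      pow_one, mul_one]
  have hgmul : ∀ y ∈ insert x (Set.range e), ∀ z, φ (y * z) = φ y * φ z := by
    intro y hy z
    have hz : z ∈ Submodule.span k (Set.range (pathElem e x)) := h.span_eq_top hgen trivial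
    induction hz using Submodule.span_induction with
    | mem z hz =>
      obtain ⟨⟨a, n⟩, rfl⟩ := hz
      rw [pathElem, hφ]
      rcases hy with rfl | ⟨b, rfl⟩
      · rw [← mul_assoc, ← pow_succ', hφ, hx, pow_succ', mul_assoc]
      · rw [h.idem_mul_pow, he, h'.idem_mul_pow]
        split_ifs
        · exact hφ _ _
        · exact map_zero φ
    | zero => simp
    | add u w _ _ hu hw => rw [mul_add, map_add, map_add, mul_add, hu, hw]
    | smul c w _ hw => rw [mul_smul_comm, map_smul, map_smul, mul_smul_comm, hw]
  have hmul : ∀ y z, φ (y * z) = φ y * φ z := by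
    intro y
    have hy : y ∈ Algebra.adjoin k (insert x (Set.range e)) := by rw [hgen]; trivial
    induction hy using Algebra.adjoin_induction with
    | mem y hy => exact hgmul y hy
    | algebraMap c =>
      intro z
      rw [← Algebra.smul_def, map_smul, Algebra.algebraMap_eq_smul_one, map_smul, hone,
        smul_mul_assoc, one_mul]
    | add y z _ _ hy hz => intro w; rw [add_mul, map_add, map_add, add_mul, hy, hz]
    | mul y z _ _ hy hz => intro w; rw [mul_assoc, hy, hz, hy, mul_assoc]
  exact ⟨AlgHom.ofLinearMap φ hone hmul, he, hx⟩

end ShiftRelations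

end UniversalProperty

section Presentation

variable {k A V E : Type} [Field k] [Ring A] [Algebra k A] [Fintype V] [Fintype E]

theorem QuiverPresentation.shiftRelations (P : QuiverPresentation k A V E)
    (v : Fin 7 ≃ V) (ar : Fin 6 ≃ E)
    (hends : ∀ i : Fin 6, ∃ a b : Fin 7,
      (a : ℕ) = (ex18Ends i).1 ∧ (b : ℕ) = (ex18Ends i).2 ∧
      P.src (ar i) = v a ∧ P.tgt (ar i) = v b)
    (hrel : P.wprod [ar 0, ar 1, ar 2, ar 3, ar 4] = 0) :
    ShiftRelations (fun a => P.idem (v a)) (∑ α, P.arrow α) ∧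
      Algebra.adjoin k (insert (∑ α, P.arrow α) (Set.range fun a => P.idem (v a))) = ⊤ := by
  let s : Fin 6 → Fin 7 := ![0, 1, 2, 4, 5, 3]
  have hs : Function.Injective s := by decide
  have hst : ∀ i, P.src (ar i) = v (s i) ∧ P.tgt (ar i) = v (MeshRow.nextVert (s i)) := by
    intro i
    obtain ⟨a, b, ha, hb, h⟩ := hends i
    have h1 : ((s i : Fin 7) : ℕ) = (ex18Ends i).1 ∧
        ((MeshRow.nextVert (s i) : Fin 7) : ℕ) = (ex18Ends i).2 := by
      clear hb ha h; revert i; decide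
    rwa [Fin.ext (ha.trans h1.1.symm), Fin.ext (hb.trans h1.2.symm)] at h
  have horth : ∀ a b, P.idem (v a) * P.idem (v b) = if a = b then P.idem (v b) else 0 := by
    intro a b
    by_cases hab : a = b
    · simp [hab, P.idem_idem]
    · simp [hab, P.idem_orth _ _ (v.injective.ne hab)]
  have hmem : ∀ i, P.idem (v (MeshRow.nextVert (s i))) * P.arrow (ar i) * P.idem (v (s i)) =
      P.arrow (ar i) := fun i => by
    rw [← (hst i).1, ← (hst i).2]; exact P.arrow_mem _
  have hright : ∀ i a, P.arrow (ar i) * P.idem (v a) = if s i = a then P.arrow (ar i) else 0 := by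
    intro i a
    rw [← hmem, mul_assoc, horth]
    split_ifs with h
    · rw [h]
    · rw [mul_zero]
  have hleft : ∀ i, P.idem (v (MeshRow.nextVert (s i))) * P.arrow (ar i) = P.arrow (ar i) := by
    intro i
    conv_lhs => rw [← hmem, mul_assoc, ← mul_assoc, horth, if_pos rfl]
    rw [← mul_assoc, hmem]
  have hx : ∀ a, (∑ α, P.arrow α) * P.idem (v a) = ∑ i, if s i = a then P.arrow (ar i) else 0 := by
    intro a
    rw [← ar.sum_comp, Finset.sum_mul]
    exact Finset.sum_congr rfl fun i _ => hright i a
  have hxs : ∀ i, (∑ α, P.arrow α) * P.idem (v (s i)) = P.arrow (ar i) := by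
    intro i
    simp [hx, hs.eq_iff]
  have hx6 : (∑ α, P.arrow α) * P.idem (v 6) = 0 := by
    rw [hx]
    refine Finset.sum_eq_zero fun i _ => if_neg ?_
    revert i; decide
  have hmul : ∀ i j, MeshRow.nextVert (s i) = s j →
      ∀ y, (∑ α, P.arrow α) * (P.arrow (ar i) * y) = P.arrow (ar j) * (P.arrow (ar i) * y) := by
    intro i j hij y
    have h : P.arrow (ar i) * y = P.idem (v (s j)) * (P.arrow (ar i) * y) := by
      rw [← mul_assoc, ← hij, hleft]
    conv_lhs => rw [h, ← mul_assoc, hxs]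
  refine ⟨⟨horth, (v.sum_comp P.idem).trans P.sum_idem, fun a => ?_, hx6, ?_⟩, ?_⟩
  · by_cases ha : a = 6
    · subst ha; rw [hx6, mul_zero]
    · obtain ⟨i, rfl⟩ : ∃ i : Fin 6, s i = a := by
        have : ∀ a : Fin 7, a ≠ 6 → ∃ i, s i = a := by decide +kernel
        exact this a ha
      simp only [hxs, hleft]
  · have h0 : (∑ α, P.arrow α) * P.idem (v 0) = P.arrow (ar 0) * 1 := by
      rw [mul_one]; exact hxs 0
    simp only [pow_succ', pow_zero, mul_one, mul_assoc]
    rw [h0, hmul 0 1 rfl, hmul 1 2 rfl, hmul 2 3 rfl, hmul 3 4 rfl]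
    simpa [QuiverPresentation.wprod, mul_assoc] using hrel
  · rw [eq_top_iff, ← P.generates]
    refine Algebra.adjoin_le ?_
    have hidem : ∀ a, P.idem (v a) ∈ Algebra.adjoin k
        (insert (∑ α, P.arrow α) (Set.range fun a => P.idem (v a))) := fun a =>
      Algebra.subset_adjoin (Or.inr ⟨a, rfl⟩)
    rintro _ (⟨b, rfl⟩ | ⟨α, rfl⟩)
    · obtain ⟨a, rfl⟩ := v.surjective b
      exact hidem a
    · obtain ⟨i, rfl⟩ := ar.surjective α
      rw [← hxs]
      exact mul_mem (Algebra.subset_adjoin (Or.inl rfl)) (hidem _)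

end Presentation

/-! ## The indecomposable modules -/

section Modules

/-- The matrix with the given code. -/
def codeMatrix (k : Type) [Field k] (m n N : ℕ) : Matrix (Fin m) (Fin n) k :=
  Matrix.of fun r p => ((MeshRow.trit N n r p : ℤ) : k)

/-- The successors of a vertex of the Auslander–Reiten quiver. -/
abbrev MeshRow.Succ (i : Fin 46) : Type := {j // j ∈ succ i}

theorem MeshRow.sum_succ {M : Type} [AddCommMonoid M] (i : Fin 46) (f : Fin 46 → M) :
    ∑ j : Succ i, f j = ((succ i).map f).sum := by
  rw [← List.sum_toFinset f (nodup_succ i)]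
  exact (Finset.sum_subtype _ (fun _ => by simp) f).symm

theorem MeshRow.dot_eq_sum (N w N' w' r p : ℕ) :
    dot N w N' w' r p = ∑ q : Fin w, trit N w r q * trit N' w' q p := by
  rw [Fin.sum_univ_eq_sum_range fun q => trit N w r q * trit N' w' q p]
  have key : ∀ u, (Nat.rec 0 (fun q s =>
      match N / 3 ^ (r * w + q) % 3 with
      | 0 => s
      | 1 => s + trit N' w' q p
      | _ => s - trit N' w' q p) u : ℤ) = ∑ q ∈ Finset.range u, trit N w r q * trit N' w' q p := by
    intro u
    induction u with
    | zero => rfl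
    | succ u ih =>
      rw [Finset.sum_range_succ, ← ih]
      rcases h : N / 3 ^ (r * w + u) % 3 with _ | _ | _ <;>
        simp [show trit N w r u = _ by rw [trit, h], h, sub_eq_add_neg]
  exact key w

theorem codeMatrix_mul_apply (k : Type) [Field k] {m n l N N' : ℕ} (r : Fin m) (p : Fin l) :
    (codeMatrix k m n N * codeMatrix k n l N') r p = ((MeshRow.dot N n N' l r p : ℤ) : k) := by
  simp [Matrix.mul_apply, codeMatrix, MeshRow.dot_eq_sum]

theorem map_smul_of_adjoin_eq_top {k A M N : Type} [Field k] [Ring A] [Algebra k A]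
    [AddCommGroup M] [Module k M] [Module A M] [IsScalarTower k A M]
    [AddCommGroup N] [Module k N] [Module A N] [IsScalarTower k A N] {S : Set A}
    (hS : Algebra.adjoin k S = ⊤) (f : M →ₗ[k] N) (hf : ∀ s ∈ S, ∀ m, f (s • m) = s • f m)
    (a : A) (m : M) : f (a • m) = a • f m := by
  have ha : a ∈ Algebra.adjoin k S := hS ▸ trivial
  induction ha using Algebra.adjoin_induction generalizing m with
  | mem s hs => exact hf s hs m
  | algebraMap c => rw [algebraMap_smul, algebraMap_smul, map_smul]
  | add a b _ _ ha hb => rw [add_smul, add_smul, map_add, ha, hb]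
  | mul a b _ _ ha hb => rw [mul_smul, mul_smul, ha, hb]

/-- The matrices of the idempotents and of the sum of all arrows on the module `i` satisfy the
relations of the algebra. -/
theorem shiftRelations_matrix (k : Type) [Field k] (i : Fin 46) :
    ShiftRelations (A := Matrix (Fin (MeshRow.dim i)) (Fin (MeshRow.dim i)) k)
      (fun a => Matrix.diagonal fun r => if MeshRow.vert i r = a then 1 else 0)
      (codeMatrix k _ _ (MeshRow.shiftCode i)) := by
  have hgr : ∀ r p : Fin (MeshRow.dim i),
      codeMatrix k _ _ (MeshRow.shiftCode i) r p = 0 ∨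
        MeshRow.vert i p ≠ 6 ∧ MeshRow.vert i r = MeshRow.nextVert (MeshRow.vert i p) := by
    intro r p
    rcases MeshRow.shiftCode_graded i r r.2 p p.2 with h | h
    · left; simp [codeMatrix, h]
    · exact Or.inr h
  have hpow : ∀ n : ℕ, ∀ r p : Fin (MeshRow.dim i),
      (codeMatrix k _ _ (MeshRow.shiftCode i) ^ n) r p = 0 ∨
        MeshRow.vert i r = MeshRow.nextVert^[n] (MeshRow.vert i p) := by
    intro n
    induction n with
    | zero =>
      intro r p
      by_cases h : r = p
      · right; rw [h]; rfl
      · simp [Matrix.one_apply_ne h]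
    | succ n ih =>
      intro r p
      by_contra! hc
      refine hc.1 ?_
      rw [pow_succ', Matrix.mul_apply]
      refine Finset.sum_eq_zero fun q _ => ?_
      rcases hgr r q with h | h
      · rw [h, zero_mul]
      · rcases ih q p with h' | h'
        · rw [h', mul_zero]
        · exact absurd (by rw [h.2, h', Function.iterate_succ_apply']) hc.2
  refine ⟨fun a b => ?_, ?_, fun a => ?_, ?_, ?_⟩
  · rw [Matrix.diagonal_mul_diagonal]
    split_ifs with h
    · subst h; congr 1; ext r; simp
    · rw [← Matrix.diagonal_zero]
      congr 1; ext r
      by_cases h1 : MeshRow.vert i r = a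
      · simp [h1, h]
      · simp [h1]
  · ext r p
    rw [Matrix.sum_apply]
    by_cases h : r = p
    · subst h; simp
    · simp [h, Matrix.one_apply_ne h]
  · ext r p
    rw [Matrix.diagonal_mul, Matrix.mul_diagonal]
    rcases hgr r p with h | h
    · simp [h]
    · by_cases ha : MeshRow.vert i p = a
      · simp [h.2, ha]
      · simp [ha]
  · ext r p
    rw [Matrix.mul_diagonal, Matrix.zero_apply]
    rcases hgr r p with h | h
    · simp [h]
    · simp [h.1]
  · ext r p
    rw [Matrix.mul_diagonal, Matrix.zero_apply]
    by_cases hp : MeshRow.vert i p = 0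
    · rcases hpow 5 r p with h | h
      · rw [h, zero_mul]
      · rw [hp] at h
        rcases MeshRow.vert_zero_six i with h0 | h6
        · exact absurd hp (h0 p p.2)
        · exact absurd h (h6 r r.2)
    · simp [hp]

/-- Representations of `A` on the coordinate spaces of the table. -/
structure Realization (k A : Type) [Field k] [Ring A] [Algebra k A] where
  e : Fin 7 → A
  x : A
  rels : ShiftRelations e x
  gen : Algebra.adjoin k (insert x (Set.range e)) = ⊤
  rep : ∀ i, A →ₐ[k] Matrix (Fin (MeshRow.dim i)) (Fin (MeshRow.dim i)) k
  rep_e : ∀ i a, rep i (e a) =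
    Matrix.diagonal fun r : Fin (MeshRow.dim i) => if MeshRow.vert i r = a then 1 else 0
  rep_x : ∀ i, rep i x = codeMatrix k _ _ (MeshRow.shiftCode i)

variable {k A : Type} [Field k] [Ring A] [Algebra k A]

theorem ShiftRelations.nonempty_realization {e : Fin 7 → A} {x : A} (h : ShiftRelations e x)
    (hgen : Algebra.adjoin k (insert x (Set.range e)) = ⊤) (hdim : Module.finrank k A = 25) :
    Nonempty (Realization k A) := by
  choose ρ h1 h2 using fun i => h.exists_algHom hgen hdim (shiftRelations_matrix k i)
  exact ⟨⟨e, x, h, hgen, ρ, h1, h2⟩⟩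

namespace Realization

variable (R : Realization k A)

/-- The module with index `i`. -/
def T (_ : Realization k A) (i : Fin 46) : Type := Fin (MeshRow.dim i) → k

instance (i : Fin 46) : AddCommGroup (R.T i) := inferInstanceAs (AddCommGroup (Fin _ → k))

instance (i : Fin 46) : Module k (R.T i) := inferInstanceAs (Module k (Fin _ → k))

instance (i : Fin 46) : Module.Finite k (R.T i) := inferInstanceAs (Module.Finite k (Fin _ → k))

instance (i : Fin 46) : Module A (R.T i) :=
  Module.compHom (Fin (MeshRow.dim i) → k)
    ((Matrix.toLinAlgEquiv' : _ ≃ₐ[k] _).toAlgHom.comp (R.rep i)).toRingHom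

theorem smul_def (i : Fin 46) (a : A) (z : R.T i) :
    a • z = ((R.rep i a).mulVec z : Fin (MeshRow.dim i) → k) := rfl

instance (i : Fin 46) : IsScalarTower k A (R.T i) := by
  refine IsScalarTower.of_algebraMap_smul fun c z => ?_
  have h : ∀ w : Fin (MeshRow.dim i) → k, (R.rep i (algebraMap k A c)).mulVec w = c • w :=
    fun w => by
      rw [AlgHom.commutes, Algebra.algebraMap_eq_smul_one, Matrix.smul_mulVec, Matrix.one_mulVec]
  exact h z

theorem finrank_T (i : Fin 46) : Module.finrank k (R.T i) = MeshRow.dim i :=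
  (Module.finrank_fin_fun k : Module.finrank k (Fin (MeshRow.dim i) → k) = _)

theorem e_smul_apply (i : Fin 46) (a : Fin 7) (z : R.T i) (r : Fin (MeshRow.dim i)) :
    (R.e a • z : R.T i) r = if MeshRow.vert i r = a then z r else 0 := by
  have h : ∀ w : Fin (MeshRow.dim i) → k,
      (R.rep i (R.e a)).mulVec w r = if MeshRow.vert i r = a then w r else 0 := fun w => by
    rw [rep_e, Matrix.mulVec_diagonal, ite_mul, one_mul, zero_mul]
  exact h z

theorem x_smul_apply (i : Fin 46) (z : R.T i) (r : Fin (MeshRow.dim i)) :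
    (R.x • z : R.T i) r =
      ∑ p : Fin (MeshRow.dim i), codeMatrix k _ _ (MeshRow.shiftCode i) r p * z p := by
  rw [smul_def, rep_x]; rfl

/-- A linear map between the modules of the table given by a code. -/
def mapOfCode (i j : Fin 46) (N : ℕ) : R.T i →ₗ[k] R.T j :=
  (Matrix.toLin' (codeMatrix k (MeshRow.dim j) (MeshRow.dim i) N) :
    (Fin (MeshRow.dim i) → k) →ₗ[k] (Fin (MeshRow.dim j) → k))

theorem mapOfCode_comp_apply (i j l : Fin 46) (N N' : ℕ) (z : R.T i) (r : Fin (MeshRow.dim l)) :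
    R.mapOfCode j l N (R.mapOfCode i j N' z) r =
      ∑ p : Fin (MeshRow.dim i),
        ((MeshRow.dot N (MeshRow.dim j) N' (MeshRow.dim i) r p : ℤ) : k) * z p := by
  have h : ∀ w : Fin (MeshRow.dim i) → k,
      (codeMatrix k (MeshRow.dim l) (MeshRow.dim j) N).mulVec
        ((codeMatrix k (MeshRow.dim j) (MeshRow.dim i) N').mulVec w) r =
      ∑ p : Fin (MeshRow.dim i),
        ((MeshRow.dot N (MeshRow.dim j) N' (MeshRow.dim i) r p : ℤ) : k) * w p := fun w => by
    rw [Matrix.mulVec_mulVec]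
    simp only [Matrix.mulVec, dotProduct, codeMatrix_mul_apply]
  exact h z

/-- The irreducible map `i → j`. -/
def F (i : Fin 46) (j : MeshRow.Succ i) : R.T i →ₗ[A] R.T j where
  toFun := R.mapOfCode i j (MeshRow.arrowCode i j)
  map_add' := map_add _
  map_smul' := by
    refine map_smul_of_adjoin_eq_top R.gen _ ?_
    rintro s (rfl | ⟨a, rfl⟩) z
    · have hx : ∀ l (w : R.T l), R.x • w = R.mapOfCode l l (MeshRow.shiftCode l) w := fun l w => by
        rw [smul_def, rep_x]; rfl
      rw [hx, hx]
      funext r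
      rw [mapOfCode_comp_apply, mapOfCode_comp_apply]
      exact Finset.sum_congr rfl fun p _ => by
        rw [MeshRow.arrowCode_shift i j j.2 r r.2 p p.2]
    · funext r
      rw [e_smul_apply]
      change ∑ p, _ * (R.e a • z : R.T i) p = if _ then ∑ p, _ * z p else 0
      rw [Finset.ite_sum_zero]
      refine Finset.sum_congr rfl fun p _ => ?_
      rw [e_smul_apply]
      rcases MeshRow.arrowCode_graded i j j.2 r r.2 p p.2 with h | h
      · simp [codeMatrix, h]
      · rw [h, mul_ite, mul_zero]

theorem sum_apply {ι : Type} (s : Finset ι) (i : Fin 46) (z : ι → R.T i)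
    (r : Fin (MeshRow.dim i)) : (∑ l ∈ s, z l) r = ∑ l ∈ s, z l r :=
  Finset.sum_apply (M := fun _ : Fin (MeshRow.dim i) => k) r s z

theorem F_apply (i : Fin 46) (j : MeshRow.Succ i) (z : R.T i) :
    R.F i j z = R.mapOfCode i j (MeshRow.arrowCode i j) z := rfl

/-- The irreducible map from a middle term of the mesh at `i` to its end. -/
def toEnd {i y : Fin 46} (hy : y ∈ (MeshRow.row i).translate) (j : MeshRow.Succ i) :
    R.T j →ₗ[A] R.T y :=
  R.F j ⟨y, MeshRow.mem_succ_of_translate i y hy j j.2⟩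

theorem toEnd_apply {i y : Fin 46} (hy : y ∈ (MeshRow.row i).translate) (j : MeshRow.Succ i)
    (z : R.T j) : R.toEnd hy j z = R.mapOfCode j y (MeshRow.arrowCode j y) z := rfl

theorem sum_F_F {i y : Fin 46} (hy : y ∈ (MeshRow.row i).translate) (z : R.T i) :
    ∑ j : MeshRow.Succ i, R.toEnd hy j (R.F i j z) = 0 := by
  funext r
  change Fin (MeshRow.dim y) at r
  refine (R.sum_apply _ y _ r).trans ?_
  simp only [F_apply, toEnd_apply]
  have h : ∀ j : MeshRow.Succ i, R.mapOfCode j y (MeshRow.arrowCode j y)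
      (R.mapOfCode i j (MeshRow.arrowCode i j) z) r = _ := fun j =>
    R.mapOfCode_comp_apply i j y _ _ z r
  refine (Finset.sum_congr rfl fun j _ => h j).trans ?_
  rw [Finset.sum_comm]
  refine Finset.sum_eq_zero fun p _ => ?_
  rw [← Finset.sum_mul, ← Int.cast_sum, MeshRow.sum_succ i fun j =>
    MeshRow.dot (MeshRow.arrowCode j y) (MeshRow.dim j) (MeshRow.arrowCode i j) (MeshRow.dim i) r p,
    MeshRow.mesh_comp i y hy r r.2 p p.2, Int.cast_zero, zero_mul]

theorem sum_F_section {i y : Fin 46} (hy : y ∈ (MeshRow.row i).translate) (z : R.T y) :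
    ∑ j : MeshRow.Succ i, R.toEnd hy j
      (R.mapOfCode y j (MeshRow.sectionCode i j) z) = z := by
  funext r
  change Fin (MeshRow.dim y) at r
  refine (R.sum_apply _ y _ r).trans ?_
  simp only [toEnd_apply]
  have h : ∀ j : MeshRow.Succ i, R.mapOfCode j y (MeshRow.arrowCode j y)
      (R.mapOfCode y j (MeshRow.sectionCode i j) z) r = _ := fun j =>
    R.mapOfCode_comp_apply y j y _ _ z r
  refine (Finset.sum_congr rfl fun j _ => h j).trans ?_
  rw [Finset.sum_comm, Finset.sum_eq_single r]
  · rw [← Finset.sum_mul, ← Int.cast_sum, MeshRow.sum_succ i fun j => MeshRow.dot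
      (MeshRow.arrowCode j y) (MeshRow.dim j) (MeshRow.sectionCode i j) (MeshRow.dim y) r r,
      MeshRow.mesh_section i y hy r r.2 r r.2, if_pos rfl, Int.cast_one, one_mul]
  · intro p _ hp
    rw [← Finset.sum_mul, ← Int.cast_sum, MeshRow.sum_succ i fun j => MeshRow.dot
      (MeshRow.arrowCode j y) (MeshRow.dim j) (MeshRow.sectionCode i j) (MeshRow.dim y) r p,
      MeshRow.mesh_section i y hy r r.2 p p.2, if_neg (fun h => hp (Fin.ext h.symm)),
      Int.cast_zero, zero_mul]
  · exact fun h => absurd (Finset.mem_univ _) h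

/-- The linear retraction onto the start of a mesh. -/
def retract (i : Fin 46) (z : ∀ l : MeshRow.Succ i, R.T l) : R.T i :=
  ∑ l : MeshRow.Succ i, R.mapOfCode l i (MeshRow.retractCode i l) (z l)

theorem sum_ite_mul_apply {i : Fin 46} (z : ∀ l : MeshRow.Succ i, R.T l) (j : MeshRow.Succ i)
    (r : Fin (MeshRow.dim j)) :
    ∑ l : MeshRow.Succ i, ∑ p : Fin (MeshRow.dim l),
      (((if (j : Fin 46) = l ∧ (r : ℕ) = p then 1 else 0 : ℤ)) : k) * z l p = z j r := by
  rw [Finset.sum_eq_single j, Finset.sum_eq_single r]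
  · simp
  · intro p _ hp
    rw [if_neg (fun h => hp (Fin.ext h.2.symm)), Int.cast_zero, zero_mul]
  · exact fun h => absurd (Finset.mem_univ _) h
  · intro l _ hl
    refine Finset.sum_eq_zero fun p _ => ?_
    rw [if_neg (fun h => hl (Subtype.ext h.1.symm)), Int.cast_zero, zero_mul]
  · exact fun h => absurd (Finset.mem_univ _) h

theorem F_retract_add {i y : Fin 46} (hy : y ∈ (MeshRow.row i).translate)
    (z : ∀ l : MeshRow.Succ i, R.T l) (j : MeshRow.Succ i) :
    R.F i j (R.retract i z) + R.mapOfCode y j (MeshRow.sectionCode i j)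
      (∑ l : MeshRow.Succ i, R.toEnd hy l (z l)) = z j := by
  funext r
  change Fin (MeshRow.dim j) at r
  rw [retract, map_sum]
  have h : R.mapOfCode y j (MeshRow.sectionCode i j)
      (∑ l : MeshRow.Succ i, R.toEnd hy l (z l)) =
      ∑ l : MeshRow.Succ i, R.mapOfCode y j (MeshRow.sectionCode i j)
        (R.mapOfCode l y (MeshRow.arrowCode l y) (z l)) := map_sum _ _ _
  rw [h, ← Finset.sum_add_distrib]
  refine (R.sum_apply _ j _ r).trans (Eq.trans ?_ (R.sum_ite_mul_apply z j r))
  refine Finset.sum_congr rfl fun l _ => ?_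
  refine (congrArg₂ (· + ·) (R.mapOfCode_comp_apply l i j _ _ (z l) r)
    (R.mapOfCode_comp_apply l y j _ _ (z l) r)).trans ?_
  rw [← Finset.sum_add_distrib]
  refine Finset.sum_congr rfl fun p _ => ?_
  rw [← add_mul, ← Int.cast_add, MeshRow.mesh_split i y hy j j.2 l l.2 r r.2 p p.2]

theorem F_retract {i : Fin 46} (hi : (MeshRow.row i).translate = none)
    (z : ∀ l : MeshRow.Succ i, R.T l) (j : MeshRow.Succ i) :
    R.F i j (R.retract i z) = z j := by
  funext r
  change Fin (MeshRow.dim j) at r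
  rw [retract, map_sum]
  refine (R.sum_apply _ j _ r).trans (Eq.trans ?_ (R.sum_ite_mul_apply z j r))
  refine Finset.sum_congr rfl fun l _ => ?_
  refine (R.mapOfCode_comp_apply l i j _ _ (z l) r).trans ?_
  refine Finset.sum_congr rfl fun p _ => ?_
  rw [MeshRow.end_split i hi j j.2 l l.2 r r.2 p p.2]

end Realization

end Modules

/-! ## Projective modules -/

section Projectives

variable {k A : Type} [Field k] [Ring A] [Algebra k A]

namespace Realization

variable (R : Realization k A)

/-- The canonical generator of an indecomposable projective module. -/
def top (a : Fin 7) : R.T (MeshRow.proj a) :=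
  fun r : Fin (MeshRow.dim (MeshRow.proj a)) => if (r : ℕ) = 0 then 1 else 0

theorem e_smul_top (a : Fin 7) : R.e a • R.top a = R.top a := by
  funext r
  change Fin (MeshRow.dim (MeshRow.proj a)) at r
  refine (R.e_smul_apply _ a _ r).trans ?_
  rw [MeshRow.vert_proj a r r.2]
  by_cases h : (r : ℕ) = 0
  · rw [h]; exact if_pos rfl
  · rw [show R.top a r = 0 from if_neg h, ite_self]

theorem x_smul_proj_apply (a : Fin 7) (z : R.T (MeshRow.proj a))
    (r : Fin (MeshRow.dim (MeshRow.proj a))) :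
    (R.x • z : R.T (MeshRow.proj a)) r =
      ∑ p : Fin (MeshRow.dim (MeshRow.proj a)), if (r : ℕ) = p + 1 then z p else 0 := by
  rw [R.x_smul_apply]
  refine Finset.sum_congr rfl fun p _ => ?_
  rw [codeMatrix, Matrix.of_apply, MeshRow.shiftCode_proj a r r.2 p p.2]
  split_ifs <;> simp

theorem pow_smul_top (a : Fin 7) (n : ℕ) (r : Fin (MeshRow.dim (MeshRow.proj a))) :
    (R.x ^ n • R.top a : R.T (MeshRow.proj a)) r = if (r : ℕ) = n then 1 else 0 := by
  induction n generalizing r with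
  | zero => rw [pow_zero, one_smul]; rfl
  | succ n ih =>
    rw [pow_succ', mul_smul, x_smul_proj_apply]
    simp only [ih]
    by_cases h : (r : ℕ) = n + 1
    · rw [if_pos h, Finset.sum_eq_single ⟨n, by omega⟩]
      · simp [h]
      · intro p _ hp
        rw [if_neg (c := (p : ℕ) = n) (fun h' => hp (Fin.ext h')), ite_self]
      · exact fun h => absurd (Finset.mem_univ _) h
    · rw [if_neg h]
      refine Finset.sum_eq_zero fun p _ => ?_
      by_cases hp : (p : ℕ) = n
      · rw [if_neg (by omega)]
      · rw [if_neg hp, ite_self]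

theorem eq_sum_pow_smul_top (a : Fin 7) (z : R.T (MeshRow.proj a)) :
    z = ∑ r : Fin (MeshRow.dim (MeshRow.proj a)), z r • (R.x ^ (r : ℕ) • R.top a) := by
  funext r
  change Fin (MeshRow.dim (MeshRow.proj a)) at r
  refine Eq.trans ?_ (R.sum_apply _ _ _ r).symm
  have h : ∀ q : Fin (MeshRow.dim (MeshRow.proj a)),
      (z q • (R.x ^ (q : ℕ) • R.top a) : R.T (MeshRow.proj a)) r =
        z q * if (r : ℕ) = q then 1 else 0 := fun q =>
    congrArg (z q * ·) (R.pow_smul_top a q r)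
  refine Eq.trans ?_ (Finset.sum_congr rfl fun q _ => (h q).symm)
  rw [Finset.sum_eq_single r]
  · simp
  · intro q _ hq
    rw [if_neg (fun h => hq (Fin.ext h.symm)), mul_zero]
  · exact fun h => absurd (Finset.mem_univ _) h

variable {N : Type} [AddCommGroup N] [Module k N] [Module A N] [IsScalarTower k A N]

theorem hom_proj_apply {a : Fin 7} (h : R.T (MeshRow.proj a) →ₗ[A] N) (z : R.T (MeshRow.proj a)) :
    h z = ∑ r : Fin (MeshRow.dim (MeshRow.proj a)), z r • (R.x ^ (r : ℕ) • h (R.top a)) := by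
  conv_lhs => rw [R.eq_sum_pow_smul_top a z]
  rw [map_sum]
  exact Finset.sum_congr rfl fun r _ => by
    rw [LinearMap.map_smul_of_tower, map_smul]

theorem exists_hom_proj (a : Fin 7) (n : N) :
    ∃ h : R.T (MeshRow.proj a) →ₗ[A] N, h (R.top a) = R.e a • n := by
  let f : R.T (MeshRow.proj a) →ₗ[k] N :=
    { toFun := fun z => ∑ r : Fin (MeshRow.dim (MeshRow.proj a)),
        z r • ((R.x ^ (r : ℕ) * R.e a) • n)
      map_add' := fun y z => by
        rw [← Finset.sum_add_distrib]
        exact Finset.sum_congr rfl fun r _ => add_smul (y r) (z r) _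
      map_smul' := fun c z => by
        rw [RingHom.id_apply, Finset.smul_sum]
        exact Finset.sum_congr rfl fun r _ => mul_smul c (z r) _ }
  have hf : ∀ z, f z = ∑ r : Fin (MeshRow.dim (MeshRow.proj a)),
        z r • ((R.x ^ (r : ℕ) * R.e a) • n) := fun _ => rfl
  refine ⟨{ f with map_smul' := map_smul_of_adjoin_eq_top R.gen f ?_ }, ?_⟩
  · rintro s (rfl | ⟨b, rfl⟩) z
    · rw [hf, hf, Finset.smul_sum]
      simp only [x_smul_proj_apply, Finset.sum_smul]
      rw [Finset.sum_comm]
      refine Finset.sum_congr rfl fun p _ => ?_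
      rw [smul_comm, ← mul_smul R.x, ← mul_assoc, ← pow_succ']
      by_cases hp : (p : ℕ) + 1 < MeshRow.dim (MeshRow.proj a)
      · rw [Finset.sum_eq_single ⟨p + 1, hp⟩]
        · simp
        · intro r _ hr
          rw [if_neg (fun h => hr (Fin.ext h)), zero_smul]
        · exact fun h => absurd (Finset.mem_univ _) h
      · rw [R.rels.pow_mul_eq_zero a (p + 1) (by rw [← MeshRow.dim_proj]; omega), zero_smul,
          smul_zero]
        refine Finset.sum_eq_zero fun r _ => ?_
        rw [if_neg (by omega), zero_smul]
    · rw [hf, hf, Finset.smul_sum]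
      refine Finset.sum_congr rfl fun r _ => ?_
      rw [e_smul_apply, smul_comm (R.e b), ← mul_smul (R.e b), R.rels.idem_mul_pow,
        MeshRow.vert_proj a r r.2]
      split_ifs <;> simp
  · change f (R.top a) = _
    rw [hf, Finset.sum_eq_single ⟨0, MeshRow.dim_pos _⟩]
    · simp [top]
    · intro r _ hr
      rw [show R.top a r = 0 from if_neg fun h => hr (Fin.ext h), zero_smul]
    · exact fun h => absurd (Finset.mem_univ _) h

theorem hom_proj_ext {a : Fin 7} {h h' : R.T (MeshRow.proj a) →ₗ[A] N}
    (hh : h (R.top a) = h' (R.top a)) : h = h' := by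
  ext z
  rw [R.hom_proj_apply h, R.hom_proj_apply h', hh]

/-- A module is the sum of the values of the maps from the indecomposable projectives. -/
theorem exists_eq_sum_hom_proj (n : N) :
    ∃ h : ∀ a, R.T (MeshRow.proj a) →ₗ[A] N, n = ∑ a, h a (R.top a) := by
  choose h hh using fun a => R.exists_hom_proj (k := k) a n
  exact ⟨h, by simp only [hh]; rw [← Finset.sum_smul, R.rels.sum_idem, one_smul]⟩

/-- Evaluation of the maps from the indecomposable projectives at the canonical generators. -/
noncomputable def homProjEquiv : (∀ a, R.T (MeshRow.proj a) →ₗ[A] N) ≃ₗ[k] N :=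
  LinearEquiv.ofBijective
    { toFun := fun h => ∑ a, h a (R.top a)
      map_add' := fun g h => by rw [← Finset.sum_add_distrib]; rfl
      map_smul' := fun c h => by rw [RingHom.id_apply, Finset.smul_sum]; rfl }
    ⟨by
      rw [injective_iff_map_eq_zero]
      intro h hh
      change ∑ a, h a (R.top a) = 0 at hh
      funext b
      refine R.hom_proj_ext ?_
      rw [Pi.zero_apply, LinearMap.zero_apply, ← smul_zero (R.e b), ← hh, Finset.smul_sum,
        Finset.sum_eq_single b]
      · rw [← map_smul, e_smul_top]
      · intro a _ ha
        rw [← R.e_smul_top a, map_smul, ← mul_smul, R.rels.idem_mul, if_neg ha.symm, zero_smul]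
      · exact fun h => absurd (Finset.mem_univ _) h,
    fun n => (R.exists_eq_sum_hom_proj (k := k) n).imp fun _ h => h.symm⟩

theorem hom_proj_eq_zero {a : Fin 7} {j : Fin 46} (hj : ∀ r < MeshRow.dim j, MeshRow.vert j r ≠ a)
    (h : R.T (MeshRow.proj a) →ₗ[A] R.T j) : h = 0 := by
  refine R.hom_proj_ext ?_
  rw [← R.e_smul_top a, map_smul, LinearMap.zero_apply]
  funext r
  change Fin (MeshRow.dim j) at r
  exact (R.e_smul_apply j a _ r).trans (if_neg (hj r r.2))

theorem exists_hom_proj_ne_zero {a : Fin 7} {j : Fin 46} {r : ℕ} (hr : r < MeshRow.dim j)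
    (hj : MeshRow.vert j r = a) : ∃ h : R.T (MeshRow.proj a) →ₗ[A] R.T j, h ≠ 0 := by
  let z : R.T j := fun _ : Fin (MeshRow.dim j) => (1 : k)
  obtain ⟨h, hh⟩ := R.exists_hom_proj a z
  refine ⟨h, fun h0 => one_ne_zero (α := k) ?_⟩
  have := (R.e_smul_apply j a z ⟨r, hr⟩).symm
  rw [← hh, h0, if_pos hj] at this
  exact this

end Realization

end Projectives

/-! ## Multiplicities of the indecomposable summands -/

section Multiplicities

variable {k A : Type} [Field k] [Ring A] [Algebra k A]

theorem finite_linearMap_of_tower {M N : Type}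
    [AddCommGroup M] [Module k M] [Module A M] [IsScalarTower k A M] [Module.Finite k M]
    [AddCommGroup N] [Module k N] [Module A N] [IsScalarTower k A N] [Module.Finite k N] :
    Module.Finite k (M →ₗ[A] N) :=
  Module.Finite.of_injective (LinearMap.restrictScalarsₗ k A M N k)
    (LinearMap.restrictScalars_injective k)

namespace Realization

variable (R : Realization k A)

theorem sum_apply_single {N : Type} [AddCommGroup N] [Module A N] {i : Fin 46}
    (t : ∀ j : MeshRow.Succ i, R.T j →ₗ[A] N) (j : MeshRow.Succ i) (z : R.T j) :
    ∑ l, t l ((Pi.single j z : ∀ l : MeshRow.Succ i, R.T l) l) = t j z := by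
  rw [Finset.sum_eq_single j]
  · rw [Pi.single_eq_same]
  · intro l _ hl
    rw [Pi.single_eq_of_ne hl, map_zero]
  · exact fun h => absurd (Finset.mem_univ _) h

variable (N : Type) [AddCommGroup N] [Module k N] [Module A N] [IsScalarTower k A N]

instance [Module.Finite k N] (i : Fin 46) : Module.Finite k (R.T i →ₗ[A] N) :=
  finite_linearMap_of_tower

/-- The maps which factor through the middle term of the mesh at `i`. -/
def precomp (i : Fin 46) :
    (∀ j : MeshRow.Succ i, R.T j →ₗ[A] N) →ₗ[k] (R.T i →ₗ[A] N) where
  toFun t := ∑ j, (t j).comp (R.F i j)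
  map_add' t u := by
    simp only [Pi.add_apply, LinearMap.add_comp, Finset.sum_add_distrib]
  map_smul' c t := by
    simp only [Pi.smul_apply, LinearMap.smul_comp, Finset.smul_sum, RingHom.id_apply]

theorem precomp_apply (i : Fin 46) (t : ∀ j : MeshRow.Succ i, R.T j →ₗ[A] N) (z : R.T i) :
    R.precomp N i t z = ∑ j, t j (R.F i j z) := by
  simp [precomp]

/-- Composition with the maps of a mesh to its end. -/
def precompEnd {i y : Fin 46} (hy : y ∈ (MeshRow.row i).translate) :
    (R.T y →ₗ[A] N) →ₗ[k] (∀ j : MeshRow.Succ i, R.T j →ₗ[A] N) where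
  toFun u j := u.comp (R.toEnd hy j)
  map_add' _ _ := rfl
  map_smul' _ _ := rfl

theorem precompEnd_injective {i y : Fin 46} (hy : y ∈ (MeshRow.row i).translate) :
    Function.Injective (R.precompEnd N hy) := by
  rw [injective_iff_map_eq_zero]
  intro u hu
  ext z
  rw [← R.sum_F_section hy z, map_sum]
  exact Finset.sum_eq_zero fun j _ => LinearMap.congr_fun (congrFun hu j) _

theorem range_precompEnd {i y : Fin 46} (hy : y ∈ (MeshRow.row i).translate) :
    LinearMap.range (R.precompEnd N hy) = LinearMap.ker (R.precomp N i) := by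
  apply le_antisymm
  · rintro _ ⟨u, rfl⟩
    rw [LinearMap.mem_ker]
    ext z
    rw [precomp_apply, LinearMap.zero_apply, ← map_zero u, ← R.sum_F_F hy z, map_sum]
    rfl
  · intro t ht
    have ht' : ∀ z, ∑ j, t j (R.F i j z) = 0 := fun z => by
      rw [← precomp_apply, LinearMap.mem_ker.1 ht, LinearMap.zero_apply]
    let u : R.T y →ₗ[k] N := ∑ j : MeshRow.Succ i,
      ((t j).restrictScalars k).comp (R.mapOfCode y j (MeshRow.sectionCode i j))
    have hu : ∀ z, u z = ∑ j : MeshRow.Succ i, t j (R.mapOfCode y j (MeshRow.sectionCode i j) z) :=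
      fun z => by simp [u]
    have key : ∀ z : ∀ j : MeshRow.Succ i, R.T j, ∑ j, t j (z j) =
        u (∑ j, R.toEnd hy j (z j)) := fun z => by
      rw [hu, ← zero_add (∑ j : MeshRow.Succ i, t j (R.mapOfCode _ _ _ _)), ← ht' (R.retract i z),
        ← Finset.sum_add_distrib]
      exact Finset.sum_congr rfl fun j _ => by rw [← map_add, R.F_retract_add hy]
    refine ⟨{ u with map_smul' := fun a z => ?_ }, ?_⟩
    · calc u (a • z) = u (∑ j, R.toEnd hy j
            (a • R.mapOfCode y j (MeshRow.sectionCode i j) z)) := by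
            simp only [map_smul, ← Finset.smul_sum]
            rw [R.sum_F_section hy z]
        _ = ∑ j : MeshRow.Succ i, t j (a • R.mapOfCode y j (MeshRow.sectionCode i j) z) :=
            (key _).symm
        _ = a • u z := by
            rw [hu, Finset.smul_sum]
            simp only [map_smul]
    · funext j
      ext z
      have h := key (Pi.single j z)
      rw [R.sum_apply_single t j z, R.sum_apply_single (R.toEnd hy) j z] at h
      exact h.symm

theorem precomp_injective {i : Fin 46} (hi : (MeshRow.row i).translate = none) :
    Function.Injective (R.precomp N i) := by
  rw [injective_iff_map_eq_zero]
  intro t ht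
  funext j
  ext z
  have h := R.precomp_apply N i t (R.retract i (Pi.single j z))
  simp only [R.F_retract hi, ht] at h
  rw [R.sum_apply_single t j z] at h
  exact h.symm

/-- The number of summands `i` of the module `N`. -/
noncomputable def mult (i : Fin 46) : ℕ :=
  Module.finrank k ((R.T i →ₗ[A] N) ⧸ LinearMap.range (R.precomp N i))

theorem finrank_hom_add [Module.Finite k N] (i : Fin 46) :
    Module.finrank k (R.T i →ₗ[A] N) +
        ∑ y, (if y ∈ (MeshRow.row i).translate then Module.finrank k (R.T y →ₗ[A] N) else 0) =
      R.mult N i +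
        ∑ j, (if j ∈ MeshRow.succ i then Module.finrank k (R.T j →ₗ[A] N) else 0) := by
  have h1 := Submodule.finrank_quotient_add_finrank (LinearMap.range (R.precomp N i))
  have h2 := LinearMap.finrank_range_add_finrank_ker (R.precomp N i)
  have h3 : ∑ j, (if j ∈ MeshRow.succ i then Module.finrank k (R.T j →ₗ[A] N) else 0) =
      Module.finrank k (∀ j : MeshRow.Succ i, R.T j →ₗ[A] N) := by
    rw [Module.finrank_pi_fintype, ← Finset.sum_filter]
    exact Finset.sum_subtype _ (fun _ => by simp) fun j => Module.finrank k (R.T j →ₗ[A] N)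
  have h4 : ∑ y, (if y ∈ (MeshRow.row i).translate then Module.finrank k (R.T y →ₗ[A] N) else 0) =
      Module.finrank k (LinearMap.ker (R.precomp N i)) := by
    rcases h : (MeshRow.row i).translate with _ | y
    · rw [LinearMap.ker_eq_bot.2 (R.precomp_injective N h), finrank_bot]
      simp
    · rw [← R.range_precompEnd N (y := y) (by rw [h]; rfl),
        LinearMap.finrank_range_of_inj (R.precompEnd_injective N _)]
      simp
  rw [mult]
  omega

theorem sum_finrank_hom_proj [Module.Finite k N] :
    ∑ a, Module.finrank k (R.T (MeshRow.proj a) →ₗ[A] N) = Module.finrank k N := by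
  rw [← Module.finrank_pi_fintype, (R.homProjEquiv (N := N)).finrank_eq]

theorem sum_mult_mul_dim [Module.Finite k N] :
    ∑ i, R.mult N i * MeshRow.dim i = Module.finrank k N := by
  rw [← R.sum_finrank_hom_proj N]
  let d : Fin 46 → ℕ := fun i => Module.finrank k (R.T i →ₗ[A] N)
  have hadd : ∀ j, MeshRow.dim j +
      ∑ i, (if j ∈ (MeshRow.row i).translate then MeshRow.dim i else 0) =
      (if j ∈ Set.range MeshRow.proj then 1 else 0) +
        ∑ i, (if j ∈ MeshRow.succ i then MeshRow.dim i else 0) := fun j => by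
    have h := MeshRow.dim_additive j
    rw [← Fin.sum_univ_def, ← Fin.sum_univ_def] at h
    convert h using 3
    simp
  have hproj : ∑ a, d (MeshRow.proj a) =
      ∑ j, d j * if j ∈ Set.range MeshRow.proj then 1 else 0 := by
    simp only [mul_ite, mul_one, mul_zero]
    rw [← Finset.sum_filter, ← Finset.sum_image (s := Finset.univ) (g := MeshRow.proj)
      fun a _ b _ h => MeshRow.proj_injective h]
    exact Finset.sum_congr (by ext; simp) fun _ _ => rfl
  have hswap : ∀ (c : Fin 46 → Fin 46 → Prop) [∀ i j, Decidable (c i j)],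
      ∑ i, (∑ j, if c i j then d j else 0) * MeshRow.dim i =
        ∑ j, d j * ∑ i, if c i j then MeshRow.dim i else 0 := fun c _ => by
    simp only [Finset.sum_mul, Finset.mul_sum]
    rw [Finset.sum_comm]
    exact Finset.sum_congr rfl fun j _ => Finset.sum_congr rfl fun i _ => by split_ifs <;> simp
  have h1 : ∑ i, d i * MeshRow.dim i +
        ∑ i, (∑ j, if j ∈ (MeshRow.row i).translate then d j else 0) * MeshRow.dim i =
      ∑ i, R.mult N i * MeshRow.dim i +
        ∑ i, (∑ j, if j ∈ MeshRow.succ i then d j else 0) * MeshRow.dim i := by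
    simp only [← Finset.sum_add_distrib, ← add_mul]
    exact Finset.sum_congr rfl fun i _ => congrArg (· * MeshRow.dim i) (R.finrank_hom_add N i)
  have h2 : ∑ j, d j * MeshRow.dim j +
        ∑ j, d j * ∑ i, (if j ∈ (MeshRow.row i).translate then MeshRow.dim i else 0) =
      (∑ j, d j * if j ∈ Set.range MeshRow.proj then 1 else 0) +
        ∑ j, d j * ∑ i, (if j ∈ MeshRow.succ i then MeshRow.dim i else 0) := by
    simp only [← Finset.sum_add_distrib, ← mul_add]
    exact Finset.sum_congr rfl fun j _ => congrArg (d j * ·) (hadd j)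
  have h3 := hswap fun i j => j ∈ (MeshRow.row i).translate
  have h4 := hswap fun i j => j ∈ MeshRow.succ i
  change _ = ∑ a, d (MeshRow.proj a)
  rw [hproj]
  rw [h3, h4] at h1
  omega

end Realization

end Multiplicities

/-! ## Decomposition into the modules of the realization -/

section Decomposition

variable {k A : Type} [Field k] [Ring A] [Algebra k A]

namespace Realization

variable (R : Realization k A)
variable (N : Type) [AddCommGroup N] [Module k N] [Module A N] [IsScalarTower k A N]

/-- Representatives of a basis of the maps `i → N` modulo those which factor through the mesh
at `i`. -/
noncomputable def lift [Module.Finite k N] (i : Fin 46) (l : Fin (R.mult N i)) :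
    R.T i →ₗ[A] N :=
  Function.surjInv (Submodule.mkQ_surjective (LinearMap.range (R.precomp N i)))
    (Module.finBasis k _ l)

theorem exists_eq_sum_lift_add_precomp [Module.Finite k N] (i : Fin 46) (h : R.T i →ₗ[A] N) :
    ∃ (c : Fin (R.mult N i) → k) (t : ∀ j : MeshRow.Succ i, R.T j →ₗ[A] N),
      h = ∑ l, c l • R.lift N i l + R.precomp N i t := by
  let b : Module.Basis (Fin (R.mult N i)) k _ :=
    Module.finBasis k ((R.T i →ₗ[A] N) ⧸ LinearMap.range (R.precomp N i))
  let q := Submodule.mkQ (LinearMap.range (R.precomp N i))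
  have hlift : ∀ l, q (R.lift N i l) = b l := fun l =>
    Function.surjInv_eq (Submodule.mkQ_surjective _) (b l)
  have hmem : h - ∑ l, b.repr (q h) l • R.lift N i l ∈ LinearMap.range (R.precomp N i) := by
    refine (Submodule.Quotient.mk_eq_zero _).1 ?_
    change q _ = 0
    simp only [map_sub, map_sum, map_smul, hlift]
    rw [b.sum_repr, sub_self]
  obtain ⟨t, ht⟩ := hmem
  exact ⟨fun l => b.repr (q h) l, t, by rw [ht]; abel⟩

theorem exists_eq_precomp [Module.Finite k N] {i : Fin 46} (hi : R.mult N i = 0)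
    (h : R.T i →ₗ[A] N) :
    ∃ t : ∀ j : MeshRow.Succ i, R.T j →ₗ[A] N, h = R.precomp N i t := by
  obtain ⟨c, t, ht⟩ := R.exists_eq_sum_lift_add_precomp N i h
  have : IsEmpty (Fin (R.mult N i)) := by rw [hi]; infer_instance
  exact ⟨t, by rw [ht, Finset.univ_eq_empty, Finset.sum_empty, zero_add]⟩

/-- The map from the direct sum of the summands of `N`. -/
noncomputable def summandMap [Module.Finite k N] :
    (∀ q : Σ i, Fin (R.mult N i), R.T q.1) →ₗ[A] N :=
  ∑ q : Σ i, Fin (R.mult N i), (R.lift N q.1 q.2).comp (LinearMap.proj q)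

theorem summandMap_apply [Module.Finite k N] (z : ∀ q : Σ i, Fin (R.mult N i), R.T q.1) :
    R.summandMap N z = ∑ q : Σ i, Fin (R.mult N i), R.lift N q.1 q.2 (z q) := by
  simp [summandMap]

theorem summandMap_single [Module.Finite k N] (q : Σ i, Fin (R.mult N i)) (z : R.T q.1) :
    R.summandMap N (Pi.single q z) = R.lift N q.1 q.2 z := by
  rw [summandMap_apply, Finset.sum_eq_single q]
  · rw [Pi.single_eq_same]
  · intro p _ hp
    rw [Pi.single_eq_of_ne hp, map_zero]
  · exact fun h => absurd (Finset.mem_univ _) h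

theorem mem_range_summandMap [Module.Finite k N] (i : Fin 46) (h : R.T i →ₗ[A] N) (z : R.T i) :
    h z ∈ LinearMap.range (R.summandMap N) := by
  induction i using WellFoundedGT.induction with
  | ind i ih =>
    obtain ⟨c, t, rfl⟩ := R.exists_eq_sum_lift_add_precomp N i h
    rw [LinearMap.add_apply, LinearMap.sum_apply, precomp_apply]
    refine Submodule.add_mem _ (Submodule.sum_mem _ fun l _ => ?_)
      (Submodule.sum_mem _ fun j _ => ih j (MeshRow.lt_of_mem_succ i j j.2) _ _)
    rw [LinearMap.smul_apply, ← LinearMap.map_smul_of_tower]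
    exact ⟨_, R.summandMap_single N ⟨i, l⟩ (c l • z)⟩

theorem summandMap_bijective [Module.Finite k N] : Function.Bijective (R.summandMap N) := by
  have hsurj : Function.Surjective (R.summandMap N) := fun n => by
    obtain ⟨h, hn⟩ := R.exists_eq_sum_hom_proj (k := k) n
    rw [hn]
    exact Submodule.sum_mem (LinearMap.range (R.summandMap N))
      fun a _ => R.mem_range_summandMap N _ (h a) _
  refine ⟨?_, hsurj⟩
  have hdim : Module.finrank k (∀ q : Σ i, Fin (R.mult N i), R.T q.1) = Module.finrank k N := by
    rw [Module.finrank_pi_fintype, ← R.sum_mult_mul_dim N, Fintype.sum_sigma]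
    simp [finrank_T]
  exact (LinearMap.injective_iff_surjective_of_finrank_eq_finrank
    (f := (R.summandMap N).restrictScalars k) hdim).2 hsurj

theorem exists_retraction_lift [Module.Finite k N] (i : Fin 46) (l : Fin (R.mult N i)) :
    ∃ r : N →ₗ[A] R.T i, r.comp (R.lift N i l) = LinearMap.id ∧
      ∀ m, m ≠ l → r.comp (R.lift N i m) = 0 := by
  let E := LinearEquiv.ofBijective (R.summandMap N) (R.summandMap_bijective N)
  have hE : ∀ m z, E.symm (R.lift N i m z) = Pi.single (⟨i, m⟩ : Σ i, Fin (R.mult N i)) z :=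
    fun m z => by
      rw [LinearEquiv.symm_apply_eq]
      exact (R.summandMap_single N ⟨i, m⟩ z).symm
  refine ⟨(LinearMap.proj (⟨i, l⟩ : Σ i, Fin (R.mult N i))).comp E.symm.toLinearMap, ?_,
    fun m hm => ?_⟩
  · ext z
    change E.symm (R.lift N i l z) ⟨i, l⟩ = z
    rw [hE, Pi.single_eq_same]
  · ext z
    change E.symm (R.lift N i m z) ⟨i, l⟩ = 0
    rw [hE, Pi.single_eq_of_ne]
    exact fun h => hm (eq_of_heq (Sigma.mk.inj h).2).symm

theorem exists_mult_ne_zero [Module.Finite k N] [Nontrivial N] : ∃ i, R.mult N i ≠ 0 := by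
  by_contra! h
  have h1 := R.sum_mult_mul_dim N
  have h2 : 0 < Module.finrank k N := Module.finrank_pos
  simp only [h, zero_mul, Finset.sum_const_zero] at h1
  omega

theorem mult_le_of_id_eq_precomp {i : Fin 46} {t : ∀ j : MeshRow.Succ i, R.T j →ₗ[A] R.T i}
    (ht : LinearMap.id = R.precomp (R.T i) i t) (z : Fin 46) :
    R.mult (R.T i) z ≤ ∑ j : MeshRow.Succ i, R.mult (R.T j) z := by
  let Q : Fin 46 → Type := fun j => (R.T z →ₗ[A] R.T j) ⧸ LinearMap.range (R.precomp (R.T j) z)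
  let post : ∀ j : MeshRow.Succ i, (R.T z →ₗ[A] R.T j) →ₗ[k] (R.T z →ₗ[A] R.T i) := fun j =>
    { toFun := fun f => (t j).comp f
      map_add' := fun f g => LinearMap.comp_add f g (t j)
      map_smul' := fun c f => by
        ext w
        exact LinearMap.map_smul_of_tower (t j) c (f w) }
  have hpost : ∀ j : MeshRow.Succ i, LinearMap.range (R.precomp (R.T j) z) ≤
      (LinearMap.range (R.precomp (R.T i) z)).comap (post j) := by
    rintro j _ ⟨u, rfl⟩
    refine ⟨fun l => (t j).comp (u l), ?_⟩
    ext w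
    change _ = t j (R.precomp _ z u w)
    simp only [precomp_apply, map_sum, LinearMap.comp_apply]
  let G : (∀ j : MeshRow.Succ i, Q j) →ₗ[k] Q i :=
    ∑ j, (Submodule.mapQ _ _ (post j) (hpost j)).comp (LinearMap.proj j)
  have hG : Function.Surjective G := fun y => by
    obtain ⟨f, rfl⟩ := Submodule.mkQ_surjective _ y
    refine ⟨fun j => Submodule.mkQ _ ((R.F i j).comp f), ?_⟩
    have hf : f = ∑ j, post j ((R.F i j).comp f) := by
      ext w
      have h := LinearMap.congr_fun ht (f w)
      rw [precomp_apply] at h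
      rw [LinearMap.sum_apply]
      exact h
    conv_rhs => rw [hf, map_sum]
    simp only [G, LinearMap.sum_apply, LinearMap.comp_apply, LinearMap.proj_apply]
    rfl
  have h := LinearMap.finrank_le_finrank_of_surjective hG
  rwa [Module.finrank_pi_fintype] at h

theorem mult_T (i z : Fin 46) : R.mult (R.T i) z = if z = i then 1 else 0 := by
  induction i using WellFoundedGT.induction generalizing z with
  | ind i ih =>
    have hsum := R.sum_mult_mul_dim (R.T i)
    rw [finrank_T] at hsum
    have hi : R.mult (R.T i) i ≠ 0 := fun h0 => by
      obtain ⟨t, ht⟩ := R.exists_eq_precomp (R.T i) h0 LinearMap.id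
      have hle : ∀ y, R.mult (R.T i) y ≤ if y ∈ MeshRow.succ i then 1 else 0 := fun y => by
        refine (R.mult_le_of_id_eq_precomp ht y).trans (le_of_eq ?_)
        rw [Finset.sum_congr rfl fun (j : MeshRow.Succ i) _ =>
          ih j (MeshRow.lt_of_mem_succ i j j.2) y]
        rw [MeshRow.sum_succ i fun j => if y = j then 1 else 0,
          ← List.sum_toFinset _ (MeshRow.nodup_succ i), Finset.sum_ite_eq]
        simp only [List.mem_toFinset]
      let s := (MeshRow.succ i).filter fun y => decide (R.mult (R.T i) y = 1)
      refine MeshRow.dim_ne_sum i s (List.mem_sublists.2 List.filter_sublist) ?_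
      rw [← hsum, ← List.sum_toFinset MeshRow.dim ((MeshRow.nodup_succ i).filter _)]
      refine Finset.sum_subset_zero_on_sdiff (Finset.subset_univ _) (fun y hy => ?_)
        fun y hy => ?_
      · have := hle y
        simp only [Finset.mem_sdiff, Finset.mem_univ, true_and, List.mem_toFinset,
          List.mem_filter, decide_eq_true_eq, not_and] at hy
        split_ifs at this with hm
        · rw [show R.mult (R.T i) y = 0 from by have := hy hm; omega, zero_mul]
        · rw [Nat.le_zero.1 this, zero_mul]
      · simp only [List.mem_toFinset, List.mem_filter, decide_eq_true_eq] at hy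
        rw [hy.2, one_mul]
    rw [← Finset.add_sum_erase _ _ (Finset.mem_univ i)] at hsum
    have hd := MeshRow.dim_pos i
    have h1 : R.mult (R.T i) i = 1 := by
      by_contra hne
      have : 2 ≤ R.mult (R.T i) i := by omega
      have := Nat.mul_le_mul_right (MeshRow.dim i) this
      omega
    split_ifs with hz
    · rw [hz, h1]
    · have h0 : ∑ y ∈ Finset.univ.erase i, R.mult (R.T i) y * MeshRow.dim y = 0 := by
        rw [h1] at hsum
        omega
      have := Finset.sum_eq_zero_iff.1 h0 z (Finset.mem_erase.2 ⟨hz, Finset.mem_univ _⟩)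
      have hd' := MeshRow.dim_pos z
      rcases Nat.mul_eq_zero.1 this with h | h
      · exact h
      · omega

theorem hom_eq_zero_of_lt {i z : Fin 46} (hz : i < z) (f : R.T z →ₗ[A] R.T i) : f = 0 := by
  induction z using WellFoundedGT.induction with
  | ind z ih =>
    obtain ⟨t, rfl⟩ := R.exists_eq_precomp (R.T i) (i := z)
      (by rw [mult_T, if_neg hz.ne']) f
    have h0 : t = 0 := funext fun j =>
      ih j (MeshRow.lt_of_mem_succ z j j.2) (hz.trans (MeshRow.lt_of_mem_succ z j j.2)) _
    rw [h0, map_zero]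

theorem exists_eq_smul_id (i : Fin 46) (f : R.T i →ₗ[A] R.T i) :
    ∃ c : k, f = c • LinearMap.id := by
  have hone : R.mult (R.T i) i = 1 := by rw [mult_T, if_pos rfl]
  have h : ∃ φ : R.T i →ₗ[A] R.T i, ∀ g : R.T i →ₗ[A] R.T i, ∃ c : k, g = c • φ := by
    have : Unique (Fin (R.mult (R.T i) i)) := by rw [hone]; infer_instance
    refine ⟨R.lift (R.T i) i default, fun g => ?_⟩
    obtain ⟨c, t, ht⟩ := R.exists_eq_sum_lift_add_precomp (R.T i) i g
    have h0 : t = 0 := funext fun j =>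
      R.hom_eq_zero_of_lt (MeshRow.lt_of_mem_succ i j j.2) _
    rw [h0, map_zero, add_zero, Fintype.sum_unique] at ht
    exact ⟨c default, ht⟩
  obtain ⟨φ, hφ⟩ := h
  obtain ⟨c, hc⟩ := hφ f
  obtain ⟨d, hd⟩ := hφ LinearMap.id
  rcases eq_or_ne d 0 with rfl | hd0
  · refine ⟨0, ?_⟩
    rw [zero_smul] at hd ⊢
    ext z
    have h0 : z = 0 := LinearMap.congr_fun hd z
    rw [h0, map_zero, map_zero]
  · exact ⟨c * d⁻¹, by rw [hd, smul_smul, mul_assoc, inv_mul_cancel₀ hd0, mul_one, hc]⟩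

end Realization

end Decomposition

/-! ## The radical of the module category -/

section Radical

variable {k A : Type} [Field k] [Ring A] [Algebra k A]

theorem exists_tower (k : Type) {A : Type} [Field k] [Ring A] [Algebra k A]
    [FiniteDimensional k A] (M : ModuleCat.{0} A) [Module.Finite A M] :
    ∃ _ : Module k M, IsScalarTower k A M ∧ Module.Finite k M := by
  let _ : Module k M := Module.compHom M (algebraMap k A)
  have h : IsScalarTower k A M := IsScalarTower.of_algebraMap_smul fun _ _ => rfl
  exact ⟨inferInstance, h, Module.Finite.trans A M⟩

theorem comp_mem_radPowSet {X X' Y : ModuleCat.{0} A} {n : ℕ} (u : X' ⟶ X) {f : X ⟶ Y}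
    (hf : f ∈ radPowSet A n X Y) : u ≫ f ∈ radPowSet A n X' Y := by
  cases n with
  | zero => exact Set.mem_univ _
  | succ n =>
    obtain ⟨M, g, h, hM, hg, hh, rfl⟩ := hf
    refine ⟨M, u ≫ g, h, hM, fun L hL a b => ?_, hh, (Category.assoc _ _ _).symm⟩
    have := hg L hL (a ≫ u) b
    rwa [Category.assoc, ← Category.assoc u] at this

theorem radPowSet_succ_subset (n : ℕ) (X Y : ModuleCat.{0} A) :
    radPowSet A (n + 1) X Y ⊆ radPowSet A n X Y := by
  induction n generalizing X with
  | zero => exact Set.subset_univ _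
  | succ n ih =>
    rintro _ ⟨M, g, h, hM, hg, hh, rfl⟩
    exact ⟨M, g, h, hM, hg, ih M hh, rfl⟩

namespace Realization

variable (R : Realization k A)

/-- The module with index `i` as an object of the module category. -/
abbrev obj (i : Fin 46) : ModuleCat.{0} A := ModuleCat.of A (R.T i)

instance (i : Fin 46) : Module.Finite A (R.T i) := Module.Finite.of_restrictScalars_finite k A _

instance (i : Fin 46) : Nontrivial (R.T i) :=
  Module.nontrivial_of_finrank_pos (R := k) (by rw [finrank_T]; exact MeshRow.dim_pos i)

theorem finIndec_obj (i : Fin 46) : FinIndec A (R.obj i) := by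
  refine ⟨inferInstanceAs (Module.Finite A (R.T i)), inferInstanceAs (Nontrivial (R.T i)),
    fun f hf => ?_⟩
  obtain ⟨c, hc⟩ := R.exists_eq_smul_id i f.hom
  obtain ⟨z, hz⟩ := exists_ne (0 : R.T i)
  have h : c • c • z = c • z := by
    have := LinearMap.congr_fun (congrArg ModuleCat.Hom.hom hf) z
    rw [ModuleCat.hom_comp, hc] at this
    exact this
  rw [← sub_eq_zero, smul_smul, ← sub_smul, smul_eq_zero_iff_left hz, sub_eq_zero] at h
  rcases eq_or_ne c 0 with h0 | h0
  · left
    ext1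
    rw [hc, h0, zero_smul]
    rfl
  · right
    ext1
    rw [hc, mul_right_cancel₀ h0 (h.trans (one_mul c).symm), one_smul]
    rfl

theorem exists_eq_precomp_of_mem_radSet {N : ModuleCat.{0} A} [Module k N] [IsScalarTower k A N]
    [Module.Finite k N] {i : Fin 46} {f : R.obj i ⟶ N} (hf : f ∈ radSet A (R.obj i) N) :
    ∃ t : ∀ j : MeshRow.Succ i, R.T j →ₗ[A] N, f.hom = R.precomp N i t := by
  obtain ⟨c, t, ht⟩ := R.exists_eq_sum_lift_add_precomp N i f.hom
  suffices h : ∀ l, c l = 0 by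
    refine ⟨t, ?_⟩
    rw [ht]
    simp [h]
  intro l
  by_contra hl
  obtain ⟨r, hr, hr'⟩ := R.exists_retraction_lift N i l
  have h0 : ∀ z, r (R.precomp N i t z) = 0 := fun z => by
    rw [precomp_apply, map_sum]
    exact Finset.sum_eq_zero fun j _ => LinearMap.congr_fun
      (R.hom_eq_zero_of_lt (MeshRow.lt_of_mem_succ i j j.2) (r.comp (t j))) _
  have hz : ∀ z, r (f.hom z) = c l • z := fun z => by
    rw [ht, LinearMap.add_apply, map_add, h0, add_zero, LinearMap.sum_apply, map_sum,
      Finset.sum_eq_single l]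
    · rw [LinearMap.smul_apply, LinearMap.map_smul_of_tower]
      exact congrArg (c l • ·) (LinearMap.congr_fun hr z)
    · intro m _ hm
      rw [LinearMap.smul_apply, LinearMap.map_smul_of_tower]
      exact (congrArg (c m • ·) (LinearMap.congr_fun (hr' m hm) z)).trans (smul_zero _)
    · exact fun h => absurd (Finset.mem_univ _) h
  refine hf (R.obj i) (R.finIndec_obj i) (𝟙 _) (ModuleCat.ofHom ((c l)⁻¹ • r)) ?_
  have hid : 𝟙 _ ≫ f ≫ ModuleCat.ofHom ((c l)⁻¹ • r) = 𝟙 (R.obj i) := by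
    ext z
    change (c l)⁻¹ • r (f.hom z) = z
    rw [hz, inv_smul_smul₀ hl]
  rw [hid]
  infer_instance

theorem mem_radSet_of_lt {i j : Fin 46} (hij : i < j) (f : R.obj i ⟶ R.obj j) :
    f ∈ radSet A (R.obj i) (R.obj j) := by
  intro M hM h h' hiso
  have hzero : h' ≫ inv (h ≫ f ≫ h') ≫ h = 0 := by
    ext1
    exact R.hom_eq_zero_of_lt hij _
  have h0 : h = 0 := by
    have := IsIso.hom_inv_id_assoc (h ≫ f ≫ h') h
    rw [Category.assoc, Category.assoc, hzero, Limits.comp_zero, Limits.comp_zero] at this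
    exact this.symm
  obtain ⟨m, hm⟩ := @exists_ne M hM.2.1 0
  have hid := IsIso.hom_inv_id (h ≫ f ≫ h')
  simp only [h0, Limits.zero_comp] at hid
  exact hm (LinearMap.congr_fun (congrArg ModuleCat.Hom.hom hid) m).symm

theorem repFinite (R : Realization k A) [FiniteDimensional k A] : RepFinite A := by
  refine ⟨46, R.obj, fun M hM => ?_⟩
  have := hM.1
  have := hM.2.1
  obtain ⟨_, _, _⟩ := exists_tower k M
  obtain ⟨i, hi⟩ := R.exists_mult_ne_zero M
  let l : Fin (R.mult M i) := ⟨0, Nat.pos_of_ne_zero hi⟩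
  obtain ⟨r, hr, -⟩ := R.exists_retraction_lift M i l
  let a : R.obj i ⟶ M := ModuleCat.ofHom (R.lift M i l)
  let b : M ⟶ R.obj i := ModuleCat.ofHom r
  have hab : a ≫ b = 𝟙 (R.obj i) := by
    ext1
    exact hr
  refine ⟨i, ⟨⟨b, a, ?_, hab⟩⟩⟩
  refine (hM.2.2 (b ≫ a) (by rw [Category.assoc, reassoc_of% hab])).resolve_left fun h0 => ?_
  obtain ⟨z, hz⟩ := exists_ne (0 : R.T i)
  have h1 : 𝟙 (R.obj i) = 0 := by
    rw [← hab, ← Category.comp_id (a ≫ b), ← hab, Category.assoc, ← Category.assoc b, h0,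
      Limits.zero_comp, Limits.comp_zero]
  exact hz (LinearMap.congr_fun (congrArg ModuleCat.Hom.hom h1) z)

theorem exists_hom_ne_zero_of_mem_radPowSet [FiniteDimensional k A] {X N : ModuleCat.{0} A} {n : ℕ}
    {i : Fin 46} {f : R.obj i ⟶ N} (hf : f ∈ radPowSet A n (R.obj i) N) (u : X ⟶ R.obj i)
    (hu : u ≫ f ≠ 0) :
    ∃ z, MeshRow.lvl z = MeshRow.lvl i + n ∧ ∃ g : R.obj i ⟶ R.obj z, u ≫ g ≠ 0 := by
  induction n generalizing i with
  | zero =>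
    refine ⟨i, rfl, 𝟙 _, fun h => hu ?_⟩
    rw [Category.comp_id] at h
    rw [h, Limits.zero_comp]
  | succ n ih =>
    obtain ⟨M, g, h, hM, hg, hh, rfl⟩ := hf
    obtain ⟨_, _, _⟩ := exists_tower k M
    obtain ⟨t, ht⟩ := R.exists_eq_precomp_of_mem_radSet hg
    have : ∃ j : MeshRow.Succ i,
        (u ≫ ModuleCat.ofHom (R.F i j)) ≫ ModuleCat.ofHom (t j) ≫ h ≠ 0 := by
      by_contra! hall
      refine hu ?_
      ext z
      change h.hom (g.hom (u.hom z)) = 0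
      rw [ht, precomp_apply, map_sum]
      exact Finset.sum_eq_zero fun j _ =>
        LinearMap.congr_fun (congrArg ModuleCat.Hom.hom (hall j)) z
    obtain ⟨j, hj⟩ := this
    obtain ⟨z, hz, g', hg'⟩ := ih (comp_mem_radPowSet (ModuleCat.ofHom (t j)) hh) _ hj
    refine ⟨z, ?_, ModuleCat.ofHom (R.F i j) ≫ g', by rwa [← Category.assoc]⟩
    rw [hz, MeshRow.lvl_of_mem_succ i j j.2]
    omega

theorem radVanishes (R : Realization k A) [FiniteDimensional k A] : RadVanishes A 13 := by
  intro X Y hX _ f hf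
  obtain ⟨_, _, _⟩ := exists_tower k X
  by_contra hne
  have : ∃ x : X, f.hom x ≠ 0 := by
    by_contra! hall
    exact hne (by ext x; exact hall x)
  obtain ⟨x, hx⟩ := this
  obtain ⟨h, hh⟩ := R.exists_eq_sum_hom_proj (k := k) x
  have : ∃ a, f.hom (h a (R.top a)) ≠ 0 := by
    by_contra! hall
    refine hx ?_
    rw [hh, map_sum]
    exact Finset.sum_eq_zero fun a _ => hall a
  obtain ⟨a, ha⟩ := this
  obtain ⟨z, hz, g, hg⟩ := R.exists_hom_ne_zero_of_mem_radPowSet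
    (comp_mem_radPowSet (ModuleCat.ofHom (h a)) hf) (𝟙 _) (fun h0 => ha
      (LinearMap.congr_fun (congrArg ModuleCat.Hom.hom h0) (R.top a)))
  refine hg ?_
  rw [Category.id_comp]
  ext1
  exact R.hom_proj_eq_zero (MeshRow.vert_ne_of_lvl a z hz) g.hom

theorem exists_mem_radPowSet {X : ModuleCat.{0} A} {n : ℕ} {i z : Fin 46}
    (hz : MeshRow.lvl z = MeshRow.lvl i + n) (u : X ⟶ R.obj i) (t : R.obj i ⟶ R.obj z)
    (ht : u ≫ t ≠ 0) : ∃ t' ∈ radPowSet A n (R.obj i) (R.obj z), u ≫ t' ≠ 0 := by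
  induction n generalizing i with
  | zero => exact ⟨t, Set.mem_univ _, ht⟩
  | succ n ih =>
    have hiz : i ≠ z := by
      rintro rfl
      omega
    obtain ⟨s, hs⟩ := R.exists_eq_precomp (R.T z) (by rw [mult_T, if_neg hiz]) t.hom
    have : ∃ j : MeshRow.Succ i,
        (u ≫ ModuleCat.ofHom (R.F i j)) ≫ ModuleCat.ofHom (s j) ≠ 0 := by
      by_contra! hall
      refine ht ?_
      ext x
      change t.hom (u.hom x) = 0
      rw [hs, precomp_apply]
      exact Finset.sum_eq_zero fun j _ =>
        LinearMap.congr_fun (congrArg ModuleCat.Hom.hom (hall j)) x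
    obtain ⟨j, hj⟩ := this
    have hlvl := MeshRow.lvl_of_mem_succ i j j.2
    obtain ⟨s', hs', hne⟩ := ih (by omega) _ _ hj
    rw [Category.assoc] at hne
    exact ⟨_, ⟨_, _, s', inferInstanceAs (Module.Finite A (R.T j)),
      R.mem_radSet_of_lt (MeshRow.lt_of_mem_succ i j j.2) _, hs', rfl⟩, hne⟩

theorem le_of_radVanishes (R : Realization k A) {l : ℕ} (hl : RadVanishes A l) : 13 ≤ l := by
  obtain ⟨hv, hlvl⟩ := MeshRow.exists_target
  obtain ⟨h, hne⟩ := R.exists_hom_proj_ne_zero (MeshRow.dim_pos 45) hv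
  obtain ⟨t, ht, ht0⟩ := R.exists_mem_radPowSet hlvl (𝟙 _) (ModuleCat.ofHom h) fun h0 =>
    hne (congrArg ModuleCat.Hom.hom h0)
  rw [Category.id_comp] at ht0
  by_contra! hlt
  refine ht0 (hl _ _ (inferInstanceAs (Module.Finite A (R.T _)))
    (inferInstanceAs (Module.Finite A (R.T _))) t ?_)
  exact antitone_nat_of_succ_le (f := fun n => radPowSet A n (R.obj _) (R.obj _))
    (fun n => radPowSet_succ_subset n _ _) (Nat.lt_succ_iff.1 hlt) ht

end Realization

end Radical

/-- Example 3.16: the algebra `A = kQ_A/⟨λδγβα⟩` on the quiver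
`1 →α 2 →β 3 →γ 5 →δ 6 →λ 7` with an extra arrow `4 → 3` is representation-finite and the
nilpotency index of the radical of `mod A` equals `13`. -/
theorem nilpotency_index_example (k A : Type) [Field k] [IsAlgClosed k] [Ring A] [Algebra k A]
    [FiniteDimensional k A] (V E : Type) [Fintype V] [Fintype E]
    (P : QuiverPresentation k A V E) (hadm : P.Admissible) (hmin : P.Minimal)
    (hmono : P.Monomial)
    (v : Fin 7 ≃ V) (ar : Fin 6 ≃ E)
    (hends : ∀ i : Fin 6, ∃ a b : Fin 7,
      (a : ℕ) = (ex18Ends i).1 ∧ (b : ℕ) = (ex18Ends i).2 ∧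
      P.src (ar i) = v a ∧ P.tgt (ar i) = v b)
    (hrel : P.wprod [ar 0, ar 1, ar 2, ar 3, ar 4] = 0)
    (hsub : ∀ l₁ l₂ l₃ : List E, [ar 0, ar 1, ar 2, ar 3, ar 4] = l₁ ++ l₂ ++ l₃ →
      l₂.length < 5 → P.wprod l₂ ≠ 0)
    (hdim : Module.finrank k A = 25) :
    RepFinite A ∧ NilpotencyIndex A 13 := by
  obtain ⟨h, hgen⟩ := P.shiftRelations v ar hends hrel
  obtain ⟨R⟩ := h.nonempty_realization hgen hdim
  exact ⟨R.repFinite, by decide, R.radVanishes, fun _ hl => R.le_of_radVanishes hl⟩
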